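/- arXiv:2301.00492 — 3 statements merged into one kernel-verified Lean document; each statement's English description precedes it below -/
import Mathlib

section
/- Assume there is ε > 0 such that A(r) − εI is nonnegative definite for all r ∈ (0,T), where A(r) = (a^{ij}(r))_{d×d}. Let g : ℝ^d → ℝ be twice continuously differentiable with g and all its first- and second-order partial derivatives bounded. Then for every x ∈ ℝ^d and 0 < s < t ≤ T: ∫_{ℝ^d} g(x+y) p_{s,t}(y) dy = g(x) + ∫_s^t Σ_{i,j} a^{ij}(ρ) (∫_{ℝ^d} ∂_i∂_j g(x+y) p_{s,ρ}(y) dy) dρ. -/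
open MeasureTheory Real Set
open scoped ENNReal NNReal

noncomputable section

/-- `ℝ^d`, modeled as `Fin d → ℝ`. -/
abbrev Rd (d : ℕ) := Fin d → ℝ

/-- The `i`-th partial derivative of `φ : ℝ^d → ℝ`. -/
def pdrv (d : ℕ) (i : Fin d) (φ : Rd d → ℝ) : Rd d → ℝ :=
  fun x => fderiv ℝ φ x (Pi.single i 1)

/-- `u` is (measurable and) locally integrable on `(0,T) × ℝ^d`:
`∫_0^t ∫_{|x|<R} |u(s,x)| dx ds < ∞` for all `t ∈ (0,T)`, `R > 0`. -/
def LocInt (d : ℕ) (T : ℝ) (u : ℝ → Rd d → ℝ) : Prop :=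
  Measurable (Function.uncurry u) ∧
  ∀ t ∈ Set.Ioo (0:ℝ) T, ∀ R : ℝ, 0 < R →
    (∫⁻ s in Set.Ioo (0:ℝ) t, ∫⁻ x in {x : Rd d | ∑ i, x i ^ 2 < R ^ 2},
      ENNReal.ofReal |u s x|) < ⊤

/-- `u` is a weak solution of
`∂ₜ u = aⁱʲ(t) u_{xⁱxʲ} + bⁱ(t) u_{xⁱ} + c(t) u + f`, `u(0,·) = 0` on `(0,T) × ℝ^d`. -/
def IsWeakSol (d : ℕ) (T : ℝ) (a : Fin d → Fin d → ℝ → ℝ) (b : Fin d → ℝ → ℝ)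
    (c : ℝ → ℝ) (f u : ℝ → Rd d → ℝ) : Prop :=
  ∀ φ : Rd d → ℝ, ContDiff ℝ (⊤ : ℕ∞) φ → HasCompactSupport φ →
    ∀ t ∈ Set.Ioo (0:ℝ) T,
      (∫ x, u t x * φ x) =
      (∫ s in Set.Ioo (0:ℝ) t, ∫ x, u s x *
          ((∑ i, ∑ j, a i j s * pdrv d i (pdrv d j φ) x)
            + (∑ i, b i s * pdrv d i φ x) + c s * φ x)) +
      (∫ s in Set.Ioo (0:ℝ) t, ∫ x, f s x * φ x)

/-- Covariance matrix `Σ(s,t) = 2 ∫_s^t A(r) dr`. -/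
def covMat (d : ℕ) (a : Fin d → Fin d → ℝ → ℝ) (s t : ℝ) : Matrix (Fin d) (Fin d) ℝ :=
  Matrix.of fun i j => 2 * ∫ r in Set.Ioo s t, a i j r

/-- Centered Gaussian density with covariance matrix `S`. -/
def gaussKernel (d : ℕ) (S : Matrix (Fin d) (Fin d) ℝ) (y : Rd d) : ℝ :=
  (2 * Real.pi) ^ (-(d : ℝ) / 2) * S.det ^ (-(1 : ℝ) / 2) *
    Real.exp (-(∑ i, S⁻¹.mulVec y i * y i) / 2)

open ProbabilityTheory Filter Topology Matrix
open scoped MatrixOrder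

/-- The centered Gaussian measure on `ℝ^d` with (positive semidefinite) covariance matrix `S`. -/
def gaussMeas (d : ℕ) (S : Matrix (Fin d) (Fin d) ℝ) : Measure (Rd d) :=
  (Measure.pi fun _ : Fin d => gaussianReal 0 1).map fun z => CFC.sqrt S *ᵥ z

lemma continuous_mulVec_const {d : ℕ} (B : Matrix (Fin d) (Fin d) ℝ) :
    Continuous fun z : Rd d => B *ᵥ z :=
  Continuous.matrix_mulVec continuous_const continuous_id

instance isProbabilityMeasure_gaussMeas (d : ℕ) (S : Matrix (Fin d) (Fin d) ℝ) :
    IsProbabilityMeasure (gaussMeas d S) :=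
  Measure.isProbabilityMeasure_map (continuous_mulVec_const _).measurable.aemeasurable

lemma integral_gaussMeas {d : ℕ} (S : Matrix (Fin d) (Fin d) ℝ) {f : Rd d → ℝ}
    (hf : Measurable f) :
    ∫ y, f y ∂gaussMeas d S =
      ∫ z, f (CFC.sqrt S *ᵥ z) ∂(Measure.pi fun _ : Fin d => gaussianReal 0 1) :=
  integral_map (continuous_mulVec_const _).measurable.aemeasurable hf.aestronglyMeasurable

lemma gaussMeas_zero (d : ℕ) : gaussMeas d 0 = Measure.dirac 0 := by
  simp [gaussMeas, Measure.map_const]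

lemma gaussMeas_eq_map_multivariateGaussian (d : ℕ) (S : Matrix (Fin d) (Fin d) ℝ) :
    gaussMeas d S = (multivariateGaussian 0 S).map WithLp.ofLp := by
  rw [multivariateGaussian, ← map_pi_eq_stdGaussian, Measure.map_map (by fun_prop) (by fun_prop),
    Measure.map_map (by fun_prop) (by fun_prop), gaussMeas]
  congr 1
  ext z i
  simp

lemma multivariateGaussian_conv {d : ℕ} {S H : Matrix (Fin d) (Fin d) ℝ}
    (hS : S.PosSemidef) (hH : H.PosSemidef) :
    (multivariateGaussian 0 S) ∗ (multivariateGaussian 0 H) = multivariateGaussian 0 (S + H) := by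
  apply Measure.ext_of_charFun
  ext x
  rw [charFun_conv, charFun_multivariateGaussian hS, charFun_multivariateGaussian hH,
    charFun_multivariateGaussian (hS.add hH), ← Complex.exp_add, Matrix.add_mulVec,
    dotProduct_add]
  congr 1
  push_cast
  simp
  ring

lemma integral_gaussMeas_add {d : ℕ} {S H : Matrix (Fin d) (Fin d) ℝ}
    (hS : S.PosSemidef) (hH : H.PosSemidef) {f : Rd d → ℝ} (hf : Measurable f) {C : ℝ}
    (hC : ∀ x, |f x| ≤ C) :
    ∫ y, f y ∂gaussMeas d (S + H) = ∫ y, ∫ z, f (y + CFC.sqrt H *ᵥ z)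
      ∂(Measure.pi fun _ : Fin d => gaussianReal 0 1) ∂gaussMeas d S := by
  have hm : Measurable (WithLp.ofLp : EuclideanSpace ℝ (Fin d) → Rd d) := by fun_prop
  have hint : ∀ (μ : Measure (EuclideanSpace ℝ (Fin d))) [IsProbabilityMeasure μ],
      Integrable (fun y => f (WithLp.ofLp y)) μ := fun μ _ =>
    Integrable.of_bound (hf.comp hm).aestronglyMeasurable C (ae_of_all _ fun _ => hC _)
  have h1 : ∀ (S : Matrix (Fin d) (Fin d) ℝ) (k : Rd d → ℝ), Measurable k →
      ∫ y, k y ∂gaussMeas d S = ∫ y, k (WithLp.ofLp y) ∂multivariateGaussian 0 S := by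
    intro S k hk
    rw [gaussMeas_eq_map_multivariateGaussian]
    exact integral_map hm.aemeasurable hk.aestronglyMeasurable
  have h2 : ∀ y : Rd d, ∫ z, f (y + CFC.sqrt H *ᵥ z)
      ∂(Measure.pi fun _ : Fin d => gaussianReal 0 1) = ∫ z, f (y + z) ∂gaussMeas d H :=
    fun y => (integral_gaussMeas H (f := fun z => f (y + z)) (by fun_prop)).symm
  simp_rw [h2]
  rw [h1 _ _ hf, h1, ← multivariateGaussian_conv hS hH, integral_conv (hint _)]
  · refine integral_congr_ae (ae_of_all _ fun y => ?_)
    exact (h1 H (fun z => f (WithLp.ofLp y + z)) (by fun_prop)).symm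
  · have : StronglyMeasurable (Function.uncurry fun y z : Rd d => f (y + z)) :=
      Measurable.stronglyMeasurable (by fun_prop)
    exact this.integral_prod_right.measurable

lemma pi_gaussianReal_eq_withDensity (d : ℕ) :
    (Measure.pi fun _ : Fin d => gaussianReal 0 1) =
      (volume : Measure (Rd d)).withDensity
        fun z => ENNReal.ofReal (∏ i, gaussianPDFReal 0 1 (z i)) := by
  refine Measure.pi_eq fun s hs => ?_
  have hint : Integrable (fun z : Rd d => ∏ i, gaussianPDFReal 0 1 (z i))
      ((volume : Measure (Rd d)).restrict (Set.univ.pi s)) := by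
    rw [volume_pi, Measure.restrict_pi_pi]
    exact Integrable.fintype_prod fun i => (integrable_gaussianPDFReal 0 1).integrableOn
  rw [withDensity_apply _ (MeasurableSet.univ_pi hs),
    ← ofReal_integral_eq_lintegral_ofReal hint
      (ae_of_all _ fun z => Finset.prod_nonneg fun i _ => gaussianPDFReal_nonneg _ _ _),
    volume_pi, Measure.restrict_pi_pi,
    integral_fintype_prod_eq_prod (f := fun _ x => gaussianPDFReal 0 1 x),
    ENNReal.ofReal_prod_of_nonneg
      fun i _ => integral_nonneg fun x => gaussianPDFReal_nonneg _ _ _]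
  exact Finset.prod_congr rfl fun i _ => (gaussianReal_apply_eq_integral 0 one_ne_zero _).symm

lemma prod_gaussianPDFReal (d : ℕ) (z : Rd d) :
    ∏ i, gaussianPDFReal 0 1 (z i) =
      (2 * Real.pi) ^ (-(d : ℝ) / 2) * Real.exp (-(z ⬝ᵥ z) / 2) := by
  simp only [gaussianPDFReal, Finset.prod_mul_distrib, ← Real.exp_sum, dotProduct]
  congr 1
  · rw [Finset.prod_const, Finset.card_univ, Fintype.card_fin, NNReal.coe_one, mul_one,
      Real.sqrt_eq_rpow, ← Real.rpow_neg (by positivity), ← Real.rpow_natCast,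
      ← Real.rpow_mul (by positivity)]
    congr 1
    ring
  · congr 1
    rw [← Finset.sum_div, Finset.sum_neg_distrib]
    simp [sq]

lemma integral_mul_gaussKernel {d : ℕ} {S : Matrix (Fin d) (Fin d) ℝ} (hS : S.PosDef)
    {f : Rd d → ℝ} (hf : Measurable f) :
    ∫ y, f y * gaussKernel d S y = ∫ y, f y ∂gaussMeas d S := by
  set B := CFC.sqrt S with hB
  have hBB : B * B = S := CFC.sqrt_mul_sqrt_self _ hS.posSemidef.nonneg
  have hBpsd : B.PosSemidef := Matrix.nonneg_iff_posSemidef.1 (CFC.sqrt_nonneg S)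
  have hdetS : S.det = B.det * B.det := by rw [← hBB, det_mul]
  have hdet : B.det ≠ 0 := fun h => hS.det_pos.ne' (by rw [hdetS, h, zero_mul])
  have hdet_pos : 0 < B.det := lt_of_le_of_ne hBpsd.det_nonneg hdet.symm
  have hBt : Bᵀ = B := by simpa [Matrix.IsSymm] using hBpsd.isHermitian
  have hvol : (volume : Measure (Rd d)) =
      ENNReal.ofReal B.det • Measure.map (Matrix.toLin' B) volume := by
    rw [Real.map_matrix_volume_pi_eq_smul_volume_pi hdet, smul_smul,
      ← ENNReal.ofReal_mul hdet_pos.le, abs_of_pos (inv_pos.2 hdet_pos),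
      mul_inv_cancel₀ hdet, ENNReal.ofReal_one, one_smul]
  have hk : Measurable (gaussKernel d S) := by
    have : Continuous fun y : Rd d => S⁻¹ *ᵥ y := continuous_mulVec_const _
    have h2 : Continuous fun y : Rd d => ∑ i, (S⁻¹ *ᵥ y) i * y i := by fun_prop
    unfold gaussKernel
    fun_prop
  have hker : ∀ z, B.det * gaussKernel d S (B *ᵥ z) = ∏ i, gaussianPDFReal 0 1 (z i) := by
    intro z
    have h1 : S.det ^ (-(1 : ℝ) / 2) = B.det⁻¹ := by
      rw [hdetS, ← sq, ← Real.rpow_natCast, ← Real.rpow_mul hdet_pos.le,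
        ← Real.rpow_neg_one]
      norm_num
    have h2 : ∑ i, (S⁻¹ *ᵥ (B *ᵥ z)) i * (B *ᵥ z) i = z ⬝ᵥ z := by
      change (S⁻¹ *ᵥ (B *ᵥ z)) ⬝ᵥ (B *ᵥ z) = _
      have hu : IsUnit B.det := hdet.isUnit
      rw [dotProduct_mulVec, ← mulVec_transpose, hBt, mulVec_mulVec, mulVec_mulVec, ← hBB,
        Matrix.mul_inv_rev, ← Matrix.mul_assoc, Matrix.mul_nonsing_inv _ hu, Matrix.one_mul,
        Matrix.nonsing_inv_mul _ hu, one_mulVec]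
    rw [prod_gaussianPDFReal, gaussKernel, h1, h2]
    field_simp
  have hchange : ∫ y, f y * gaussKernel d S y =
      B.det * ∫ z, f (B *ᵥ z) * gaussKernel d S (B *ᵥ z) := by
    nth_rewrite 1 [hvol]
    rw [integral_smul_measure, ENNReal.toReal_ofReal hdet_pos.le, smul_eq_mul]
    congr 1
    exact integral_map (f := fun y => f y * gaussKernel d S y)
      (Matrix.toLin' B).continuous_of_finiteDimensional.measurable.aemeasurable
      (hf.mul hk).aestronglyMeasurable
  rw [hchange, integral_gaussMeas S hf, pi_gaussianReal_eq_withDensity,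
    integral_withDensity_eq_integral_toReal_smul
      (Measurable.ennreal_ofReal (by
        refine Finset.measurable_prod _ fun i _ => ?_
        exact (measurable_gaussianPDFReal 0 1).comp (measurable_pi_apply i)))
      (ae_of_all _ fun _ => ENNReal.ofReal_lt_top), ← integral_const_mul]
  refine integral_congr_ae (ae_of_all _ fun z => ?_)
  simp only [smul_eq_mul]
  rw [ENNReal.toReal_ofReal (Finset.prod_nonneg fun i _ => gaussianPDFReal_nonneg _ _ _), ← hker]
  ring

section Taylor

variable {d : ℕ} {g : Rd d → ℝ}

lemma contDiff_pdrv (hg : ContDiff ℝ 2 g) (i : Fin d) : ContDiff ℝ 1 (pdrv d i g) :=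
  (hg.fderiv_right (m := 1) (by norm_num)).clm_apply contDiff_const

lemma continuous_pdrv_pdrv (hg : ContDiff ℝ 2 g) (i j : Fin d) :
    Continuous (pdrv d i (pdrv d j g)) :=
  ((contDiff_pdrv hg j).continuous_fderiv one_ne_zero).clm_apply continuous_const

lemma hasDerivAt_comp_line (hg : ContDiff ℝ 1 g) (x w : Rd d) (τ : ℝ) :
    HasDerivAt (fun τ : ℝ => g (x + τ • w)) (∑ i, w i * pdrv d i g (x + τ • w)) τ := by
  have h1 : HasDerivAt (fun τ : ℝ => x + τ • w) w τ := by
    simpa using ((hasDerivAt_id τ).smul_const w).const_add x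
  have h2 := ((hg.differentiable one_ne_zero) (x + τ • w)).hasFDerivAt.comp_hasDerivAt τ h1
  convert! h2 using 1
  have hw : w = ∑ i, Pi.single i (w i) := (Finset.univ_sum_single w).symm
  have hsum := congrArg (fderiv ℝ g (x + τ • w)) hw
  rw [hsum, map_sum]
  refine Finset.sum_congr rfl fun i _ => ?_
  have : Pi.single i (w i) = w i • (Pi.single i (1 : ℝ) : Rd d) := by
    rw [← Pi.single_smul, smul_eq_mul, mul_one]
  rw [this, map_smul, smul_eq_mul, pdrv]

/-- The remainder in the second-order Taylor expansion of `g` at `x` with increment `w`. -/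
def taylorRem (g : Rd d → ℝ) (x w : Rd d) : ℝ :=
  g (x + w) - g x - ∑ i, w i * pdrv d i g x
    - (1 / 2) * ∑ i, ∑ j, w i * w j * pdrv d i (pdrv d j g) x

lemma exists_taylorRem_eq (hg : ContDiff ℝ 2 g) (x w : Rd d) :
    ∃ θ ∈ Set.Ioo (0 : ℝ) 1, taylorRem g x w = (1 / 2) * ∑ i, ∑ j, w i * w j *
      (pdrv d i (pdrv d j g) (x + θ • w) - pdrv d i (pdrv d j g) x) := by
  set φ' : ℝ → ℝ := fun τ => ∑ j, w j * pdrv d j g (x + τ • w)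
  set φ'' : ℝ → ℝ := fun τ => ∑ j, w j * ∑ i, w i * pdrv d i (pdrv d j g) (x + τ • w)
  have h1 : ∀ τ, HasDerivAt (fun τ : ℝ => g (x + τ • w)) (φ' τ) τ :=
    hasDerivAt_comp_line (hg.of_le (by norm_num)) x w
  have h2 : ∀ τ, HasDerivAt φ' (φ'' τ) τ := fun τ =>
    HasDerivAt.fun_sum fun j _ => (hasDerivAt_comp_line (contDiff_pdrv hg j) x w τ).const_mul _
  have h3 : ∀ τ, HasDerivAt (fun τ : ℝ => g (x + τ • w) - τ * φ' 0) (φ' τ - φ' 0) τ := fun τ => by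
    simpa using (h1 τ).fun_sub ((hasDerivAt_id' τ).mul_const (φ' 0))
  have h4 : ∀ τ : ℝ, HasDerivAt (fun τ : ℝ => τ ^ 2) (2 * τ) τ := fun τ => by
    simpa using hasDerivAt_pow 2 τ
  obtain ⟨c, hc, hc'⟩ := exists_ratio_hasDerivAt_eq_ratio_slope
    (fun τ : ℝ => g (x + τ • w) - τ * φ' 0) (fun τ => φ' τ - φ' 0) zero_lt_one
    (fun τ _ => (h3 τ).continuousAt.continuousWithinAt) (fun τ _ => h3 τ)
    (fun τ : ℝ => τ ^ 2) (fun τ => 2 * τ)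
    (fun τ _ => (h4 τ).continuousAt.continuousWithinAt) (fun τ _ => h4 τ)
  obtain ⟨θ, hθ, hθ'⟩ := exists_hasDerivAt_eq_slope φ' φ'' hc.1
    (fun τ _ => (h2 τ).continuousAt.continuousWithinAt) (fun τ _ => h2 τ)
  refine ⟨θ, ⟨hθ.1, hθ.2.trans hc.2⟩, ?_⟩
  have hc0 : c ≠ 0 := hc.1.ne'
  have h5 : φ' c - φ' 0 = c * φ'' θ := by
    rw [hθ']; field_simp; ring
  have h6 : g (x + w) - g x - φ' 0 = (1 / 2) * φ'' θ := by
    simp only [h5, one_smul, zero_smul, add_zero, one_pow, one_mul, zero_mul, sub_zero,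
      zero_pow two_ne_zero] at hc'
    have : c * (2 * (g (x + w) - g x - φ' 0) - φ'' θ) = 0 := by linear_combination -hc'
    have := (mul_eq_zero.1 this).resolve_left hc0
    linarith
  have h7 : φ'' θ = ∑ i, ∑ j, w i * w j * pdrv d i (pdrv d j g) (x + θ • w) := by
    simp only [φ'', Finset.mul_sum]
    rw [Finset.sum_comm]
    exact Finset.sum_congr rfl fun i _ => Finset.sum_congr rfl fun j _ => by ring
  have h8 : φ' 0 = ∑ i, w i * pdrv d i g x := by simp [φ']
  rw [taylorRem, ← h8, h6, h7]
  simp only [mul_sub, Finset.sum_sub_distrib]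

lemma abs_sum_mul_le (w : Rd d) (b : Fin d → Fin d → ℝ) :
    |∑ i, ∑ j, w i * w j * b i j| ≤ (∑ i, ∑ j, |b i j|) * ‖w‖ ^ 2 := by
  rw [Finset.sum_mul]
  refine (Finset.abs_sum_le_sum_abs _ _).trans (Finset.sum_le_sum fun i _ => ?_)
  rw [Finset.sum_mul]
  refine (Finset.abs_sum_le_sum_abs _ _).trans (Finset.sum_le_sum fun j _ => ?_)
  rw [abs_mul, abs_mul, mul_comm, sq]
  have hi : |w i| ≤ ‖w‖ := norm_le_pi_norm w i
  have hj : |w j| ≤ ‖w‖ := norm_le_pi_norm w j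
  gcongr

lemma abs_taylorRem_le (hg : ContDiff ℝ 2 g) {C : ℝ}
    (hC : ∀ x i j, |pdrv d i (pdrv d j g) x| ≤ C) (x w : Rd d) :
    |taylorRem g x w| ≤ (d : ℝ) ^ 2 * C * ‖w‖ ^ 2 := by
  obtain ⟨θ, -, hθ⟩ := exists_taylorRem_eq hg x w
  rw [hθ, abs_mul]
  have h1 := abs_sum_mul_le w fun i j =>
    pdrv d i (pdrv d j g) (x + θ • w) - pdrv d i (pdrv d j g) x
  have h2 : ∑ i, ∑ j, |pdrv d i (pdrv d j g) (x + θ • w) - pdrv d i (pdrv d j g) x| ≤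
      ∑ _i : Fin d, ∑ _j : Fin d, 2 * C :=
    Finset.sum_le_sum fun i _ => Finset.sum_le_sum fun j _ =>
      (abs_sub _ _).trans (by linarith [hC (x + θ • w) i j, hC x i j])
  have h3 : ∑ _i : Fin d, ∑ _j : Fin d, 2 * C = (d : ℝ) ^ 2 * (2 * C) := by simp; ring
  have h4 := h1.trans (mul_le_mul_of_nonneg_right (h2.trans h3.le) (sq_nonneg ‖w‖))
  rw [abs_of_pos (by norm_num : (0 : ℝ) < 1 / 2)]
  linarith

lemma taylorRem_isLittleO (hg : ContDiff ℝ 2 g) (x : Rd d) :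
    taylorRem g x =o[𝓝 0] fun w => ‖w‖ ^ 2 := by
  set m : Rd d → ℝ := fun v =>
    ∑ i, ∑ j, |pdrv d i (pdrv d j g) (x + v) - pdrv d i (pdrv d j g) x| with hm
  have hmc : Continuous m := by
    have := fun i j => continuous_pdrv_pdrv hg i j
    fun_prop
  have hm0 : m 0 = 0 := by simp [hm]
  rw [Asymptotics.isLittleO_iff]
  intro c hc
  have hev : ∀ᶠ v in 𝓝 0, m v < c := by
    have := hmc.tendsto 0
    rw [hm0] at this
    exact this.eventually_lt_const hc
  obtain ⟨δ, hδ, hball⟩ := Metric.eventually_nhds_iff.1 hev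
  refine Metric.eventually_nhds_iff.2 ⟨δ, hδ, fun w hw => ?_⟩
  obtain ⟨θ, hθ, h⟩ := exists_taylorRem_eq hg x w
  have h1 := abs_sum_mul_le w fun i j =>
    pdrv d i (pdrv d j g) (x + θ • w) - pdrv d i (pdrv d j g) x
  have h2 : m (θ • w) < c := by
    refine hball ?_
    rw [dist_zero_right] at hw ⊢
    rw [norm_smul, Real.norm_of_nonneg hθ.1.le]
    nlinarith [norm_nonneg w, hθ.2]
  have h4 := h1.trans (mul_le_mul_of_nonneg_right h2.le (sq_nonneg ‖w‖))
  rw [h, Real.norm_eq_abs, abs_mul, abs_of_pos (by norm_num : (0 : ℝ) < 1 / 2),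
    Real.norm_of_nonneg (sq_nonneg _)]
  have := mul_nonneg hc.le (sq_nonneg ‖w‖)
  linarith

lemma continuous_taylorRem (hg : ContDiff ℝ 2 g) :
    Continuous (Function.uncurry (taylorRem g)) := by
  have h0 := hg.continuous
  have h1 := fun i => (contDiff_pdrv hg i).continuous
  have h2 := fun i j => continuous_pdrv_pdrv hg i j
  unfold taylorRem Function.uncurry
  fun_prop

end Taylor

section Expansion

variable {d : ℕ}

/-- The standard Gaussian measure on `ℝ^d`, as a product measure. -/
local notation "γ" => (Measure.pi fun _ : Fin d => gaussianReal 0 1)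

lemma integrable_norm_sq_gaussian : Integrable (fun z : Rd d => ‖z‖ ^ 2) γ := by
  have h : Integrable (fun z : Rd d => ∑ i, z i ^ 2) γ := by
    refine integrable_finsetSum _ fun i _ => ?_
    have h2 : Integrable (fun x : ℝ => x ^ 2) (gaussianReal 0 1) :=
      (memLp_id_gaussianReal 2).integrable_sq
    exact integrable_comp_eval (μ := fun _ : Fin d => gaussianReal 0 1) (i := i) h2
  refine h.mono' (by fun_prop) (ae_of_all _ fun z => ?_)
  rw [Real.norm_of_nonneg (sq_nonneg _)]
  have hle : ‖z‖ ≤ √(∑ i, z i ^ 2) := (pi_norm_le_iff_of_nonneg (Real.sqrt_nonneg _)).2 fun i => by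
    rw [Real.norm_eq_abs]
    exact Real.abs_le_sqrt (Finset.single_le_sum (f := fun i => z i ^ 2)
      (fun _ _ => sq_nonneg _) (Finset.mem_univ i))
  calc ‖z‖ ^ 2 ≤ √(∑ i, z i ^ 2) ^ 2 := by gcongr
    _ = _ := Real.sq_sqrt (Finset.sum_nonneg fun _ _ => sq_nonneg _)

lemma norm_sqrt_mulVec_sq_le {H : Matrix (Fin d) (Fin d) ℝ} (hH : H.PosSemidef) (z : Rd d) :
    ‖CFC.sqrt H *ᵥ z‖ ^ 2 ≤ (∑ i, ∑ j, |H i j|) * ‖z‖ ^ 2 := by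
  set B := CFC.sqrt H with hB
  have hBB : B * B = H := CFC.sqrt_mul_sqrt_self _ hH.nonneg
  have hBt : Bᵀ = B := by
    have hBpsd : B.PosSemidef := Matrix.nonneg_iff_posSemidef.1 (CFC.sqrt_nonneg H)
    simpa [Matrix.IsSymm] using hBpsd.isHermitian
  have h1 : (B *ᵥ z) ⬝ᵥ (B *ᵥ z) = ∑ i, ∑ j, z i * z j * H i j := by
    rw [dotProduct_mulVec, ← mulVec_transpose, hBt, mulVec_mulVec, hBB, dotProduct_comm]
    simp only [dotProduct, mulVec, Finset.mul_sum]
    exact Finset.sum_congr rfl fun i _ => Finset.sum_congr rfl fun j _ => by ring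
  have h2 : ‖B *ᵥ z‖ ≤ √((B *ᵥ z) ⬝ᵥ (B *ᵥ z)) :=
    (pi_norm_le_iff_of_nonneg (Real.sqrt_nonneg _)).2 fun i => by
      rw [Real.norm_eq_abs]
      refine Real.abs_le_sqrt ?_
      rw [sq]
      exact Finset.single_le_sum (f := fun i => (B *ᵥ z) i * (B *ᵥ z) i)
        (fun _ _ => mul_self_nonneg _) (Finset.mem_univ i)
  have h3 : 0 ≤ (B *ᵥ z) ⬝ᵥ (B *ᵥ z) := Finset.sum_nonneg fun _ _ => mul_self_nonneg _
  calc ‖B *ᵥ z‖ ^ 2 ≤ √((B *ᵥ z) ⬝ᵥ (B *ᵥ z)) ^ 2 := by gcongr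
    _ = ∑ i, ∑ j, z i * z j * H i j := by rw [Real.sq_sqrt h3, h1]
    _ ≤ _ := (le_abs_self _).trans (abs_sum_mul_le z H)

lemma integrable_sqrt_mulVec_mul {H : Matrix (Fin d) (Fin d) ℝ} (hH : H.PosSemidef)
    (i j : Fin d) :
    Integrable (fun z : Rd d => (CFC.sqrt H *ᵥ z) i * (CFC.sqrt H *ᵥ z) j) γ := by
  have hc := continuous_mulVec_const (CFC.sqrt H)
  refine (integrable_norm_sq_gaussian.const_mul (∑ i, ∑ j, |H i j|)).mono'
    (Continuous.aestronglyMeasurable (by fun_prop)) (ae_of_all _ fun z => ?_)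
  refine le_trans ?_ (norm_sqrt_mulVec_sq_le hH z)
  rw [norm_mul, sq]
  gcongr <;> exact norm_le_pi_norm _ _

lemma integrable_sqrt_mulVec (H : Matrix (Fin d) (Fin d) ℝ) (i : Fin d) :
    Integrable (fun z : Rd d => (CFC.sqrt H *ᵥ z) i) γ := by
  simp only [mulVec, dotProduct]
  exact integrable_finsetSum _ fun j _ =>
    (integrable_eval (i := j) IsGaussian.integrable_id).const_mul _

lemma integral_sqrt_mulVec (H : Matrix (Fin d) (Fin d) ℝ) (i : Fin d) :
    ∫ z : Rd d, (CFC.sqrt H *ᵥ z) i ∂γ = 0 := by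
  simp only [mulVec, dotProduct]
  rw [integral_finsetSum _ fun j _ =>
    (integrable_eval (i := j) IsGaussian.integrable_id).const_mul _]
  simp [integral_const_mul, integral_eval]

lemma integral_sqrt_mulVec_mul {H : Matrix (Fin d) (Fin d) ℝ} (hH : H.PosSemidef)
    (i j : Fin d) :
    ∫ z : Rd d, (CFC.sqrt H *ᵥ z) i * (CFC.sqrt H *ᵥ z) j ∂γ = H i j := by
  have hm : Measurable (WithLp.ofLp : EuclideanSpace ℝ (Fin d) → Rd d) := by fun_prop
  have key : ∀ k : Rd d → ℝ, Measurable k → ∫ z, k (CFC.sqrt H *ᵥ z) ∂γ =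
      ∫ y, k (WithLp.ofLp y) ∂multivariateGaussian 0 H := fun k hk => by
    rw [← integral_gaussMeas H hk, gaussMeas_eq_map_multivariateGaussian]
    exact integral_map hm.aemeasurable hk.aestronglyMeasurable
  have hL : ∀ i : Fin d,
      MemLp (fun y : EuclideanSpace ℝ (Fin d) => y i) 2 (multivariateGaussian 0 H) := fun i =>
    (EuclideanSpace.proj i : EuclideanSpace ℝ (Fin d) →L[ℝ] ℝ).comp_memLp' IsGaussian.memLp_two_id
  have h0 : ∀ i : Fin d, ∫ y, y i ∂multivariateGaussian 0 H = 0 := fun i => by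
    rw [← integral_sqrt_mulVec H i]
    exact (key (fun z => z i) (by fun_prop)).symm
  rw [key (fun z => z i * z j) (by fun_prop), ← covariance_eval_multivariateGaussian hH i j,
    covariance_eq_sub (hL i) (hL j), h0]
  simp

variable {g : Rd d → ℝ}

lemma measurable_integral_sqrt {k : Rd d → Rd d → ℝ} (hk : Continuous (Function.uncurry k)) :
    Measurable fun y => ∫ z, k y z ∂γ :=
  hk.stronglyMeasurable.integral_prod_right.measurable

lemma integral_taylorRem (hg : ContDiff ℝ 2 g) {C : ℝ} (hC : ∀ x, |g x| ≤ C)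
    {H : Matrix (Fin d) (Fin d) ℝ} (hH : H.PosSemidef) (x : Rd d) :
    ∫ z, taylorRem g x (CFC.sqrt H *ᵥ z) ∂γ =
      ∫ z, g (x + CFC.sqrt H *ᵥ z) ∂γ - g x
        - (1 / 2) * ∑ i, ∑ j, H i j * pdrv d i (pdrv d j g) x := by
  have hB := continuous_mulVec_const (CFC.sqrt H)
  have hgc := hg.continuous
  have i1 : Integrable (fun z => g (x + CFC.sqrt H *ᵥ z)) γ :=
    Integrable.of_bound (Continuous.aestronglyMeasurable (by fun_prop)) C
      (ae_of_all _ fun _ => hC _)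
  have i3 : ∀ i ∈ Finset.univ,
      Integrable (fun z : Rd d => (CFC.sqrt H *ᵥ z) i * pdrv d i g x) γ :=
    fun i _ => (integrable_sqrt_mulVec H i).mul_const _
  have i5 : ∀ i, ∀ j ∈ Finset.univ, Integrable (fun z : Rd d =>
      (CFC.sqrt H *ᵥ z) i * (CFC.sqrt H *ᵥ z) j * pdrv d i (pdrv d j g) x) γ :=
    fun i j _ => (integrable_sqrt_mulVec_mul hH i j).mul_const _
  have i4 : ∀ i ∈ Finset.univ, Integrable (fun z : Rd d => ∑ j,
      (CFC.sqrt H *ᵥ z) i * (CFC.sqrt H *ᵥ z) j * pdrv d i (pdrv d j g) x) γ :=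
    fun i _ => integrable_finsetSum _ (i5 i)
  have j1 : Integrable (fun z => g (x + CFC.sqrt H *ᵥ z) - g x) γ := i1.sub (integrable_const _)
  have j2 : Integrable (fun z => g (x + CFC.sqrt H *ᵥ z) - g x
      - ∑ i, (CFC.sqrt H *ᵥ z) i * pdrv d i g x) γ := j1.sub (integrable_finsetSum _ i3)
  unfold taylorRem
  rw [integral_sub j2 ((integrable_finsetSum _ i4).const_mul _),
    integral_sub j1 (integrable_finsetSum _ i3),
    integral_sub i1 (integrable_const _), integral_finsetSum _ i3, integral_const_mul,
    integral_finsetSum _ i4]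
  simp_rw [integral_finsetSum _ (i5 _), integral_mul_const, integral_sqrt_mulVec,
    integral_sqrt_mulVec_mul hH]
  simp

/-- Second-order expansion of Gaussian averages in the covariance matrix. -/
lemma integral_gaussMeas_add_sub (hg : ContDiff ℝ 2 g) {C : ℝ} (hC : ∀ x, |g x| ≤ C)
    (hC2 : ∀ x i j, |pdrv d i (pdrv d j g) x| ≤ C) {S H : Matrix (Fin d) (Fin d) ℝ}
    (hS : S.PosSemidef) (hH : H.PosSemidef) (x : Rd d) :
    ∫ y, g (x + y) ∂gaussMeas d (S + H) - ∫ y, g (x + y) ∂gaussMeas d S =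
      (1 / 2) * ∑ i, ∑ j, H i j * ∫ y, pdrv d i (pdrv d j g) (x + y) ∂gaussMeas d S +
      ∫ y, ∫ z, taylorRem g (x + y) (CFC.sqrt H *ᵥ z) ∂γ ∂gaussMeas d S := by
  have hB := continuous_mulVec_const (CFC.sqrt H)
  have hgc := hg.continuous
  have hgm : Measurable fun y => g (x + y) := by fun_prop
  have hDc := fun i j => continuous_pdrv_pdrv hg i j
  have i1 : Integrable (fun y => ∫ z, g (x + y + CFC.sqrt H *ᵥ z) ∂γ) (gaussMeas d S) := by
    refine Integrable.of_bound (measurable_integral_sqrt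
      (k := fun y z => g (x + y + CFC.sqrt H *ᵥ z)) ?_).aestronglyMeasurable C
      (ae_of_all _ fun y => ?_)
    · unfold Function.uncurry; fun_prop
    · simpa using norm_integral_le_of_norm_le_const (μ := γ)
        (f := fun z => g (x + y + CFC.sqrt H *ᵥ z)) (ae_of_all _ fun z => hC _)
  have i2 : Integrable (fun y => g (x + y)) (gaussMeas d S) :=
    Integrable.of_bound hgm.aestronglyMeasurable C (ae_of_all _ fun _ => hC _)
  have i5 : ∀ i, ∀ j ∈ Finset.univ,
      Integrable (fun y => H i j * pdrv d i (pdrv d j g) (x + y)) (gaussMeas d S) :=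
    fun i j _ => (Integrable.of_bound (Continuous.aestronglyMeasurable (by fun_prop)) C
      (ae_of_all _ fun _ => hC2 _ i j)).const_mul _
  have i4 : ∀ i ∈ Finset.univ, Integrable (fun y =>
      ∑ j, H i j * pdrv d i (pdrv d j g) (x + y)) (gaussMeas d S) :=
    fun i _ => integrable_finsetSum _ (i5 i)
  have j1 : Integrable (fun y => ∫ z, g (x + y + CFC.sqrt H *ᵥ z) ∂γ - g (x + y))
    (gaussMeas d S) := i1.sub i2
  simp_rw [integral_taylorRem hg hC hH]
  rw [integral_sub j1 ((integrable_finsetSum _ i4).const_mul _), integral_sub i1 i2,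
    integral_const_mul, integral_finsetSum _ i4,
    integral_gaussMeas_add hS hH hgm fun _ => hC _]
  simp_rw [integral_finsetSum _ (i5 _), integral_const_mul, add_assoc]
  ring

lemma abs_integral_taylorRem_le (hg : ContDiff ℝ 2 g) {C : ℝ}
    (hC2 : ∀ x i j, |pdrv d i (pdrv d j g) x| ≤ C) (hC0 : 0 ≤ C)
    {H : Matrix (Fin d) (Fin d) ℝ} (hH : H.PosSemidef) (x : Rd d) :
    |∫ z, taylorRem g x (CFC.sqrt H *ᵥ z) ∂γ| ≤
      (d : ℝ) ^ 2 * C * (∫ z : Rd d, ‖z‖ ^ 2 ∂γ) * ∑ i, ∑ j, |H i j| := by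
  rw [mul_assoc, mul_comm (∫ z : Rd d, ‖z‖ ^ 2 ∂γ), ← integral_const_mul, ← integral_const_mul]
  refine norm_integral_le_of_norm_le (f := fun z => taylorRem g x (CFC.sqrt H *ᵥ z))
    ((integrable_norm_sq_gaussian.const_mul _).const_mul _) (ae_of_all _ fun z => ?_)
  refine (abs_taylorRem_le hg hC2 _ _).trans ?_
  gcongr
  exact norm_sqrt_mulVec_sq_le hH z

/-- Gaussian averages are Lipschitz along increasing covariance matrices. -/
lemma abs_integral_gaussMeas_add_sub_le (hg : ContDiff ℝ 2 g) {C : ℝ} (hC : ∀ x, |g x| ≤ C)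
    (hC2 : ∀ x i j, |pdrv d i (pdrv d j g) x| ≤ C) (hC0 : 0 ≤ C) :
    ∃ K : ℝ, 0 ≤ K ∧ ∀ S H : Matrix (Fin d) (Fin d) ℝ, S.PosSemidef → H.PosSemidef → ∀ x : Rd d,
      |∫ y, g (x + y) ∂gaussMeas d (S + H) - ∫ y, g (x + y) ∂gaussMeas d S| ≤
        K * ∑ i, ∑ j, |H i j| := by
  have hz : 0 ≤ ∫ z : Rd d, ‖z‖ ^ 2 ∂γ := integral_nonneg fun _ => sq_nonneg _
  refine ⟨C + (d : ℝ) ^ 2 * C * ∫ z : Rd d, ‖z‖ ^ 2 ∂γ, by positivity,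
    fun S H hS hH x => ?_⟩
  rw [integral_gaussMeas_add_sub hg hC hC2 hS hH, add_mul]
  refine (abs_add_le _ _).trans (add_le_add ?_ ?_)
  · have h1 : |∑ i, ∑ j, H i j * ∫ y, pdrv d i (pdrv d j g) (x + y) ∂gaussMeas d S| ≤
        C * ∑ i, ∑ j, |H i j| := by
      rw [Finset.mul_sum]
      refine (Finset.abs_sum_le_sum_abs _ _).trans (Finset.sum_le_sum fun i _ => ?_)
      rw [Finset.mul_sum]
      refine (Finset.abs_sum_le_sum_abs _ _).trans (Finset.sum_le_sum fun j _ => ?_)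
      rw [abs_mul, mul_comm]
      gcongr
      simpa using norm_integral_le_of_norm_le_const (μ := gaussMeas d S)
        (f := fun y => pdrv d i (pdrv d j g) (x + y)) (ae_of_all _ fun y => hC2 _ i j)
    rw [abs_mul, abs_of_pos (by norm_num : (0 : ℝ) < 1 / 2)]
    linarith [abs_nonneg (∑ i, ∑ j, H i j * ∫ y, pdrv d i (pdrv d j g) (x + y) ∂gaussMeas d S)]
  · simpa using norm_integral_le_of_norm_le_const (μ := gaussMeas d S)
      (f := fun y => ∫ z, taylorRem g (x + y) (CFC.sqrt H *ᵥ z) ∂γ)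
      (ae_of_all _ fun y => abs_integral_taylorRem_le hg hC2 hC0 hH (x + y))

lemma tendsto_integral_taylorRem_div (hg : ContDiff ℝ 2 g) {C : ℝ}
    (hC2 : ∀ x i j, |pdrv d i (pdrv d j g) x| ≤ C) (hC0 : 0 ≤ C)
    (S : Matrix (Fin d) (Fin d) ℝ) (x : Rd d) {H : ℝ → Matrix (Fin d) (Fin d) ℝ} {M : ℝ}
    (hH : ∀ᶠ h in 𝓝[>] (0 : ℝ), (H h).PosSemidef ∧ ∑ i, ∑ j, |H h i j| ≤ M * h) :
    Tendsto (fun h : ℝ => h⁻¹ * ∫ y, ∫ z, taylorRem g (x + y) (CFC.sqrt (H h) *ᵥ z) ∂γ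
      ∂gaussMeas d S) (𝓝[>] 0) (𝓝 0) := by
  have hR := continuous_taylorRem hg
  have hpos : ∀ᶠ h in 𝓝[>] (0 : ℝ), 0 < h := eventually_mem_nhdsWithin
  have hlim : Tendsto (fun h : ℝ => h) (𝓝[>] 0) (𝓝 0) := tendsto_id.mono_left nhdsWithin_le_nhds
  have inner : ∀ p : Rd d, Tendsto (fun h : ℝ =>
      ∫ z, h⁻¹ * taylorRem g p (CFC.sqrt (H h) *ᵥ z) ∂γ) (𝓝[>] 0) (𝓝 0) := by
    intro p
    have h0 : 𝓝 (0 : ℝ) = 𝓝 (∫ _z : Rd d, (0 : ℝ) ∂γ) := by simp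
    rw [h0]
    refine tendsto_integral_filter_of_dominated_convergence
      (fun z => (d : ℝ) ^ 2 * C * (M * ‖z‖ ^ 2)) (Eventually.of_forall fun h => ?_) ?_
      ((integrable_norm_sq_gaussian.const_mul _).const_mul _) (ae_of_all _ fun z => ?_)
    · have hB := continuous_mulVec_const (CFC.sqrt (H h))
      have : Continuous fun z : Rd d => taylorRem g p (CFC.sqrt (H h) *ᵥ z) :=
        hR.comp (continuous_const.prodMk hB)
      exact (this.const_mul _).aestronglyMeasurable
    · filter_upwards [hH, hpos] with h hh h0
      refine ae_of_all _ fun z => ?_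
      rw [norm_mul, norm_inv, Real.norm_of_nonneg h0.le, inv_mul_le_iff₀ h0]
      refine (abs_taylorRem_le hg hC2 _ _).trans ?_
      have h1 := norm_sqrt_mulVec_sq_le hh.1 z
      have h2 := h1.trans (mul_le_mul_of_nonneg_right hh.2 (sq_nonneg ‖z‖))
      have := mul_le_mul_of_nonneg_left h2 (by positivity : 0 ≤ (d : ℝ) ^ 2 * C)
      linarith
    · have hsq : ∀ᶠ h in 𝓝[>] (0 : ℝ), ‖CFC.sqrt (H h) *ᵥ z‖ ^ 2 ≤ M * ‖z‖ ^ 2 * h := by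
        filter_upwards [hH] with h hh
        have h1 := norm_sqrt_mulVec_sq_le hh.1 z
        have h2 := h1.trans (mul_le_mul_of_nonneg_right hh.2 (sq_nonneg ‖z‖))
        linarith
      have hw : Tendsto (fun h => CFC.sqrt (H h) *ᵥ z) (𝓝[>] 0) (𝓝 0) := by
        rw [tendsto_zero_iff_norm_tendsto_zero]
        have h1 : Tendsto (fun h => ‖CFC.sqrt (H h) *ᵥ z‖ ^ 2) (𝓝[>] 0) (𝓝 0) := by
          refine squeeze_zero' (Eventually.of_forall fun _ => sq_nonneg _) hsq ?_
          simpa using hlim.const_mul (M * ‖z‖ ^ 2)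
        simpa [Real.sqrt_sq (norm_nonneg _)] using h1.sqrt
      have ho := (taylorRem_isLittleO hg p).comp_tendsto hw
      have hO : ((fun w : Rd d => ‖w‖ ^ 2) ∘ fun h => CFC.sqrt (H h) *ᵥ z) =O[𝓝[>] 0]
          fun h : ℝ => h := by
        refine Asymptotics.IsBigO.of_bound (M * ‖z‖ ^ 2) ?_
        filter_upwards [hsq, hpos] with h hh h0
        rw [Function.comp_apply, Real.norm_of_nonneg (sq_nonneg _), Real.norm_of_nonneg h0.le]
        exact hh
      simpa [div_eq_inv_mul] using (ho.trans_isBigO hO).tendsto_div_nhds_zero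
  have hrw : ∀ h : ℝ, h⁻¹ * ∫ y, ∫ z, taylorRem g (x + y) (CFC.sqrt (H h) *ᵥ z) ∂γ
      ∂gaussMeas d S = ∫ y, ∫ z, h⁻¹ * taylorRem g (x + y) (CFC.sqrt (H h) *ᵥ z) ∂γ
      ∂gaussMeas d S := fun h => by simp_rw [integral_const_mul]
  simp_rw [hrw]
  have h0 : 𝓝 (0 : ℝ) = 𝓝 (∫ _y : Rd d, (0 : ℝ) ∂gaussMeas d S) := by simp
  rw [h0]
  refine tendsto_integral_filter_of_dominated_convergence
    (fun _ => (d : ℝ) ^ 2 * C * (∫ z : Rd d, ‖z‖ ^ 2 ∂γ) * M) (Eventually.of_forall fun h => ?_)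
    ?_ (integrable_const _) (ae_of_all _ fun y => inner (x + y))
  · have hB := continuous_mulVec_const (CFC.sqrt (H h))
    refine (measurable_integral_sqrt
      (k := fun y z => h⁻¹ * taylorRem g (x + y) (CFC.sqrt (H h) *ᵥ z)) ?_).aestronglyMeasurable
    have : Continuous fun q : Rd d × Rd d => taylorRem g (x + q.1) (CFC.sqrt (H h) *ᵥ q.2) :=
      hR.comp ((continuous_const.add continuous_fst).prodMk (hB.comp continuous_snd))
    exact this.const_mul _
  · filter_upwards [hH, hpos] with h hh h0
    refine ae_of_all _ fun y => ?_
    rw [integral_const_mul, norm_mul, norm_inv, Real.norm_of_nonneg h0.le, inv_mul_le_iff₀ h0]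
    refine (abs_integral_taylorRem_le hg hC2 hC0 hh.1 _).trans ?_
    have hz : 0 ≤ ∫ z : Rd d, ‖z‖ ^ 2 ∂γ := integral_nonneg fun _ => sq_nonneg _
    have := mul_le_mul_of_nonneg_left hh.2
      (by positivity : 0 ≤ (d : ℝ) ^ 2 * C * ∫ z : Rd d, ‖z‖ ^ 2 ∂γ)
    linarith

end Expansion

lemma intervalIntegrable_fun_sum {d : ℕ} {f : Fin d → ℝ → ℝ} {p q : ℝ}
    (h : ∀ i, IntervalIntegrable (f i) volume p q) :
    IntervalIntegrable (fun r => ∑ i, f i r) volume p q := by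
  have hsum := IntervalIntegrable.sum Finset.univ fun i _ => h i
  rwa [Finset.sum_fn] at hsum

lemma AbsolutelyContinuousOnInterval.of_dist_le {X Y : Type*} [PseudoMetricSpace X]
    [PseudoMetricSpace Y] {f : ℝ → X} {V : ℝ → Y} {a b K : ℝ}
    (hV : AbsolutelyContinuousOnInterval V a b)
    (h : ∀ p ∈ Set.uIcc a b, ∀ q ∈ Set.uIcc a b, dist (f p) (f q) ≤ K * dist (V p) (V q)) :
    AbsolutelyContinuousOnInterval f a b := by
  have h1 := Tendsto.const_mul K hV
  rw [mul_zero] at h1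
  refine squeeze_zero' (Eventually.of_forall fun E => Finset.sum_nonneg fun _ _ => dist_nonneg)
    ?_ h1
  have hE : ∀ᶠ E in totalLengthFilter ⊓ 𝓟 (disjWithin a b), E ∈ disjWithin a b :=
    mem_inf_of_right (mem_principal_self _)
  filter_upwards [hE] with E hE
  rw [Finset.mul_sum]
  exact Finset.sum_le_sum fun i hi => h _ (hE.1 i hi).1 _ (hE.1 i hi).2

section Covariance

variable {d : ℕ} {T : ℝ} {a : Fin d → Fin d → ℝ → ℝ}

lemma integrableOn_of_lintegral_sum_lt_top (ha_meas : ∀ i j, Measurable (a i j))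
    (ha_int : (∫⁻ t in Set.Ioo (0:ℝ) T, ENNReal.ofReal (∑ i, ∑ j, |a i j t|)) < ⊤)
    (i j : Fin d) : IntegrableOn (a i j) (Set.Ioo 0 T) := by
  refine ⟨(ha_meas i j).aestronglyMeasurable, lt_of_le_of_lt (lintegral_mono fun t => ?_) ha_int⟩
  rw [Real.enorm_eq_ofReal_abs]
  refine ENNReal.ofReal_le_ofReal ?_
  calc |a i j t| ≤ ∑ j, |a i j t| :=
        Finset.single_le_sum (f := fun j => |a i j t|) (fun _ _ => abs_nonneg _)
          (Finset.mem_univ j)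
    _ ≤ _ := Finset.single_le_sum (f := fun i => ∑ j, |a i j t|)
          (fun _ _ => Finset.sum_nonneg fun _ _ => abs_nonneg _) (Finset.mem_univ i)

lemma intervalIntegrable_coeff {f : ℝ → ℝ} (hf : IntegrableOn f (Set.Ioo 0 T)) {p q : ℝ}
    (hp : 0 ≤ p) (hpq : p ≤ q) (hq : q ≤ T) : IntervalIntegrable f volume p q :=
  (intervalIntegrable_iff_integrableOn_Ioo_of_le hpq).2
    (hf.mono_set (Set.Ioo_subset_Ioo hp hq))

lemma covMat_apply {p q : ℝ} (hpq : p ≤ q) (i j : Fin d) :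
    covMat d a p q i j = 2 * ∫ r in p..q, a i j r := by
  rw [intervalIntegral.integral_of_le hpq, integral_Ioc_eq_integral_Ioo]
  rfl

lemma covMat_self (p : ℝ) : covMat d a p p = 0 := by
  ext i j
  simp [covMat_apply le_rfl]

lemma covMat_add (hai : ∀ i j, IntegrableOn (a i j) (Set.Ioo 0 T)) {p q r : ℝ} (hp : 0 ≤ p)
    (hpq : p ≤ q) (hqr : q ≤ r) (hr : r ≤ T) :
    covMat d a p q + covMat d a q r = covMat d a p r := by
  ext i j
  rw [Matrix.add_apply, covMat_apply hpq, covMat_apply hqr, covMat_apply (hpq.trans hqr),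
    ← mul_add, intervalIntegral.integral_add_adjacent_intervals
      (intervalIntegrable_coeff (hai i j) hp hpq (hqr.trans hr))
      (intervalIntegrable_coeff (hai i j) (hp.trans hpq) hqr hr)]

lemma sum_abs_covMat_le (hai : ∀ i j, IntegrableOn (a i j) (Set.Ioo 0 T)) {p q : ℝ} (hp : 0 ≤ p)
    (hpq : p ≤ q) (hq : q ≤ T) :
    ∑ i, ∑ j, |covMat d a p q i j| ≤ ∫ r in p..q, 2 * ∑ i, ∑ j, |a i j r| := by
  have hi := fun i j => (intervalIntegrable_coeff (hai i j) hp hpq hq).abs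
  have hs : ∀ i, IntervalIntegrable (fun r => ∑ j, |a i j r|) volume p q := fun i => by
    exact intervalIntegrable_fun_sum fun j => hi i j
  rw [intervalIntegral.integral_const_mul, intervalIntegral.integral_finsetSum fun i _ => hs i,
    Finset.mul_sum]
  refine Finset.sum_le_sum fun i _ => ?_
  rw [intervalIntegral.integral_finsetSum fun j _ => hi i j, Finset.mul_sum]
  refine Finset.sum_le_sum fun j _ => ?_
  rw [covMat_apply hpq, abs_mul, abs_two]
  gcongr
  exact intervalIntegral.abs_integral_le_integral_abs hpq

lemma dotProduct_covMat_mulVec (hai : ∀ i j, IntegrableOn (a i j) (Set.Ioo 0 T)) {p q : ℝ}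
    (hp : 0 ≤ p) (hpq : p ≤ q) (hq : q ≤ T) (ξ : Fin d → ℝ) :
    ξ ⬝ᵥ (covMat d a p q *ᵥ ξ) = 2 * ∫ r in p..q, ∑ i, ∑ j, a i j r * ξ i * ξ j := by
  have hi := fun i j =>
    ((intervalIntegrable_coeff (hai i j) hp hpq hq).mul_const (ξ i)).mul_const (ξ j)
  have hs : ∀ i, IntervalIntegrable (fun r => ∑ j, a i j r * ξ i * ξ j) volume p q := fun i => by
    exact intervalIntegrable_fun_sum fun j => hi i j
  rw [intervalIntegral.integral_finsetSum fun i _ => hs i]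
  simp only [dotProduct, mulVec, Finset.mul_sum]
  refine Finset.sum_congr rfl fun i _ => ?_
  rw [intervalIntegral.integral_finsetSum fun j _ => hi i j, Finset.mul_sum]
  refine Finset.sum_congr rfl fun j _ => ?_
  rw [covMat_apply hpq, intervalIntegral.integral_mul_const, intervalIntegral.integral_mul_const]
  ring

lemma le_dotProduct_covMat_mulVec (hai : ∀ i j, IntegrableOn (a i j) (Set.Ioo 0 T)) {ε : ℝ}
    (hunif : ∀ r ∈ Set.Ioo (0:ℝ) T, ∀ ξ : Fin d → ℝ,
      ε * ∑ i, ξ i ^ 2 ≤ ∑ i, ∑ j, a i j r * ξ i * ξ j) {p q : ℝ}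
    (hp : 0 ≤ p) (hpq : p ≤ q) (hq : q ≤ T) (ξ : Fin d → ℝ) :
    2 * ((q - p) * (ε * ∑ i, ξ i ^ 2)) ≤ ξ ⬝ᵥ (covMat d a p q *ᵥ ξ) := by
  have hi := fun i j =>
    ((intervalIntegrable_coeff (hai i j) hp hpq hq).mul_const (ξ i)).mul_const (ξ j)
  have hs : ∀ i, IntervalIntegrable (fun r => ∑ j, a i j r * ξ i * ξ j) volume p q := fun i => by
    exact intervalIntegrable_fun_sum fun j => hi i j
  have ht : IntervalIntegrable (fun r => ∑ i, ∑ j, a i j r * ξ i * ξ j) volume p q := by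
    exact intervalIntegrable_fun_sum hs
  rw [dotProduct_covMat_mulVec hai hp hpq hq]
  have h := intervalIntegral.integral_mono_on_of_le_Ioo hpq
    (intervalIntegrable_const (c := ε * ∑ i, ξ i ^ 2)) ht
    fun r hr => hunif r (Set.Ioo_subset_Ioo hp hq hr) ξ
  rw [intervalIntegral.integral_const, smul_eq_mul] at h
  linarith

lemma isHermitian_covMat (ha_symm : ∀ t ∈ Set.Ioo (0:ℝ) T, ∀ i j, a i j t = a j i t) {p q : ℝ}
    (hp : 0 ≤ p) (hq : q ≤ T) : (covMat d a p q).IsHermitian := by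
  ext i j
  simp only [conjTranspose_apply, star_trivial, covMat, Matrix.of_apply]
  congr 1
  exact setIntegral_congr_fun measurableSet_Ioo
    fun r hr => ha_symm r (Set.Ioo_subset_Ioo hp hq hr) j i

lemma posSemidef_covMat (hai : ∀ i j, IntegrableOn (a i j) (Set.Ioo 0 T))
    (ha_symm : ∀ t ∈ Set.Ioo (0:ℝ) T, ∀ i j, a i j t = a j i t) {ε : ℝ} (hε : 0 < ε)
    (hunif : ∀ r ∈ Set.Ioo (0:ℝ) T, ∀ ξ : Fin d → ℝ,
      ε * ∑ i, ξ i ^ 2 ≤ ∑ i, ∑ j, a i j r * ξ i * ξ j) {p q : ℝ}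
    (hp : 0 ≤ p) (hpq : p ≤ q) (hq : q ≤ T) : (covMat d a p q).PosSemidef := by
  refine .of_dotProduct_mulVec_nonneg (isHermitian_covMat ha_symm hp hq) fun ξ => ?_
  refine le_trans ?_ (le_dotProduct_covMat_mulVec hai hunif hp hpq hq ξ)
  have : 0 ≤ q - p := by linarith
  have := Finset.sum_nonneg fun i (_ : i ∈ Finset.univ) => sq_nonneg (ξ i)
  positivity

lemma posDef_covMat (hai : ∀ i j, IntegrableOn (a i j) (Set.Ioo 0 T))
    (ha_symm : ∀ t ∈ Set.Ioo (0:ℝ) T, ∀ i j, a i j t = a j i t) {ε : ℝ} (hε : 0 < ε)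
    (hunif : ∀ r ∈ Set.Ioo (0:ℝ) T, ∀ ξ : Fin d → ℝ,
      ε * ∑ i, ξ i ^ 2 ≤ ∑ i, ∑ j, a i j r * ξ i * ξ j) {p q : ℝ}
    (hp : 0 ≤ p) (hpq : p < q) (hq : q ≤ T) : (covMat d a p q).PosDef := by
  refine .of_dotProduct_mulVec_pos (isHermitian_covMat ha_symm hp hq) fun ξ hξ => ?_
  refine lt_of_lt_of_le ?_ (le_dotProduct_covMat_mulVec hai hunif hp hpq.le hq ξ)
  have h1 : 0 < q - p := by linarith
  obtain ⟨i, hi⟩ := Function.ne_iff.1 hξ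
  have h2 : 0 < ∑ i, ξ i ^ 2 := Finset.sum_pos' (fun i _ => sq_nonneg (ξ i))
    ⟨i, Finset.mem_univ i, by have : ξ i ≠ 0 := hi; positivity⟩
  positivity

variable {g : Rd d → ℝ}

lemma absolutelyContinuousOnInterval_integral_gaussMeas
    (hai : ∀ i j, IntegrableOn (a i j) (Set.Ioo 0 T))
    (hpsd : ∀ p q : ℝ, 0 ≤ p → p ≤ q → q ≤ T → (covMat d a p q).PosSemidef)
    (hg : ContDiff ℝ 2 g) {C : ℝ} (hC : ∀ x, |g x| ≤ C)
    (hC2 : ∀ x i j, |pdrv d i (pdrv d j g) x| ≤ C) (x : Rd d)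
    {s t : ℝ} (hs : 0 ≤ s) (hst : s ≤ t) (ht : t ≤ T) :
    AbsolutelyContinuousOnInterval
      (fun ρ => ∫ y, g (x + y) ∂gaussMeas d (covMat d a s ρ)) s t := by
  obtain ⟨K, hK, hbound⟩ := abs_integral_gaussMeas_add_sub_le hg hC hC2
    ((abs_nonneg _).trans (hC 0))
  set m : ℝ → ℝ := fun r => 2 * ∑ i, ∑ j, |a i j r| with hm
  have hmi : IntegrableOn m (Set.Ioo 0 T) := Integrable.const_mul
    (integrable_finsetSum _ fun i _ => integrable_finsetSum _ fun j _ => (hai i j).abs) 2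
  have hmst := intervalIntegrable_coeff hmi hs hst ht
  have hV := hmst.absolutelyContinuousOnInterval_intervalIntegral (c := s) Set.left_mem_uIcc
  refine hV.of_dist_le (K := K) ?_
  rw [Set.uIcc_of_le hst]
  have hle : ∀ p ∈ Set.Icc s t, ∀ q ∈ Set.Icc s t, p ≤ q →
      dist (∫ y, g (x + y) ∂gaussMeas d (covMat d a s p))
        (∫ y, g (x + y) ∂gaussMeas d (covMat d a s q)) ≤
      K * dist (∫ r in s..p, m r) (∫ r in s..q, m r) := by
    intro p hp q hq hpq
    have hp0 : 0 ≤ p := hs.trans hp.1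
    have hqT : q ≤ T := hq.2.trans ht
    rw [dist_comm, Real.dist_eq, dist_comm (∫ r in s..p, m r), Real.dist_eq,
      ← covMat_add hai hs hp.1 hpq hqT,
      intervalIntegral.integral_interval_sub_left
        (intervalIntegrable_coeff hmi hs hq.1 hqT)
        (intervalIntegrable_coeff hmi hs hp.1 (hp.2.trans ht))]
    refine (hbound _ _ (hpsd s p hs hp.1 (hp.2.trans ht)) (hpsd p q hp0 hpq hqT) x).trans ?_
    gcongr
    exact (sum_abs_covMat_le hai hp0 hpq hqT).trans (le_abs_self _)
  intro p hp q hq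
  rcases le_total p q with h | h
  · exact hle p hp q hq h
  · rw [dist_comm, dist_comm (∫ r in s..p, m r)]
    exact hle q hq p hp h

/-- The right derivative of `ρ ↦ ∫ g(x+y) p_{s,ρ}(y) dy` at a Lebesgue point of the
coefficients. -/
lemma tendsto_slope_integral_gaussMeas
    (hai : ∀ i j, IntegrableOn (a i j) (Set.Ioo 0 T))
    (hpsd : ∀ p q : ℝ, 0 ≤ p → p ≤ q → q ≤ T → (covMat d a p q).PosSemidef)
    (hg : ContDiff ℝ 2 g) {C : ℝ} (hC : ∀ x, |g x| ≤ C)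
    (hC2 : ∀ x i j, |pdrv d i (pdrv d j g) x| ≤ C) (x : Rd d)
    {s ρ : ℝ} (hs : 0 ≤ s) (hsρ : s ≤ ρ) (hρ : ρ < T)
    (hLeb : ∀ i j, HasDerivAt (fun q => ∫ r in s..q, a i j r) (a i j ρ) ρ) :
    Tendsto (fun h : ℝ => h⁻¹ * (∫ y, g (x + y) ∂gaussMeas d (covMat d a s (ρ + h))
        - ∫ y, g (x + y) ∂gaussMeas d (covMat d a s ρ))) (𝓝[>] 0)
      (𝓝 (∑ i, ∑ j, a i j ρ *
        ∫ y, pdrv d i (pdrv d j g) (x + y) ∂gaussMeas d (covMat d a s ρ))) := by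
  have hρ0 : 0 ≤ ρ := hs.trans hsρ
  have hpos : ∀ᶠ h in 𝓝[>] (0 : ℝ), 0 < h := eventually_mem_nhdsWithin
  have hlt : ∀ᶠ h in 𝓝[>] (0 : ℝ), h < T - ρ :=
    eventually_nhdsWithin_of_eventually_nhds (eventually_lt_nhds (by linarith))
  have hcov : ∀ i j, Tendsto (fun h => h⁻¹ * covMat d a ρ (ρ + h) i j) (𝓝[>] 0)
      (𝓝 (2 * a i j ρ)) := by
    intro i j
    refine ((hLeb i j).tendsto_slope_zero_right.const_mul 2).congr' ?_
    filter_upwards [hpos, hlt] with h h0 h1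
    rw [covMat_apply (by linarith), intervalIntegral.integral_interval_sub_left
      (intervalIntegrable_coeff (hai i j) hs (by linarith) (by linarith))
      (intervalIntegrable_coeff (hai i j) hs hsρ hρ.le), smul_eq_mul]
    ring
  have hH : ∀ᶠ h in 𝓝[>] (0 : ℝ), (covMat d a ρ (ρ + h)).PosSemidef ∧
      ∑ i, ∑ j, |covMat d a ρ (ρ + h) i j| ≤ (∑ i, ∑ j, |2 * a i j ρ| + 1) * h := by
    have hsum : Tendsto (fun h => ∑ i, ∑ j, |h⁻¹ * covMat d a ρ (ρ + h) i j|) (𝓝[>] 0)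
        (𝓝 (∑ i, ∑ j, |2 * a i j ρ|)) :=
      tendsto_finsetSum _ fun i _ => tendsto_finsetSum _ fun j _ => (hcov i j).abs
    filter_upwards [hpos, hlt, hsum.eventually_le_const (lt_add_one _)] with h h0 h1 h2
    refine ⟨hpsd _ _ hρ0 (by linarith) (by linarith), ?_⟩
    simp_rw [abs_mul h⁻¹, ← Finset.mul_sum, abs_of_pos (inv_pos.2 h0)] at h2
    rwa [inv_mul_le_iff₀ h0, mul_comm] at h2
  have hrem := tendsto_integral_taylorRem_div hg hC2 ((abs_nonneg _).trans (hC 0))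
    (covMat d a s ρ) x hH
  have hmain : Tendsto (fun h => (1 / 2) * ∑ i, ∑ j, h⁻¹ * covMat d a ρ (ρ + h) i j *
      ∫ y, pdrv d i (pdrv d j g) (x + y) ∂gaussMeas d (covMat d a s ρ)) (𝓝[>] 0)
      (𝓝 ((1 / 2) * ∑ i, ∑ j, 2 * a i j ρ *
        ∫ y, pdrv d i (pdrv d j g) (x + y) ∂gaussMeas d (covMat d a s ρ))) :=
    (tendsto_finsetSum _ fun i _ => tendsto_finsetSum _ fun j _ =>
      (hcov i j).mul_const _).const_mul _
  have hlim := hmain.add hrem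
  rw [add_zero] at hlim
  have heq : (1 / 2) * ∑ i, ∑ j, 2 * a i j ρ *
        ∫ y, pdrv d i (pdrv d j g) (x + y) ∂gaussMeas d (covMat d a s ρ) =
      ∑ i, ∑ j, a i j ρ *
        ∫ y, pdrv d i (pdrv d j g) (x + y) ∂gaussMeas d (covMat d a s ρ) := by
    simp only [Finset.mul_sum]
    exact Finset.sum_congr rfl fun i _ => Finset.sum_congr rfl fun j _ => by ring
  rw [heq] at hlim
  refine hlim.congr' ?_
  filter_upwards [hpos, hlt, hH] with h h0 h1 h2
  rw [← covMat_add hai hs hsρ (by linarith : ρ ≤ ρ + h) (by linarith),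
    integral_gaussMeas_add_sub hg hC hC2 (hpsd s ρ hs hsρ hρ.le) h2.1, mul_add]
  congr 1
  simp only [Finset.mul_sum]
  exact Finset.sum_congr rfl fun i _ => Finset.sum_congr rfl fun j _ => by ring

end Covariance

/-- Gaussian identity (the analytic form of Itô's formula): for `g`
twice continuously differentiable with bounded derivatives up to order two,
`∫ g(x+y) p_{s,t}(y) dy = g(x) + ∫_s^t Σ aⁱʲ(ρ) ∫ ∂ᵢ∂ⱼ g(x+y) p_{s,ρ}(y) dy dρ`. -/
theorem stmt2 (d : ℕ) (hd : 0 < d) (T : ℝ) (hT : 0 < T)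
    (a : Fin d → Fin d → ℝ → ℝ)
    (ha_meas : ∀ i j, Measurable (a i j))
    (ha_symm : ∀ t ∈ Set.Ioo (0:ℝ) T, ∀ i j, a i j t = a j i t)
    (ha_nonneg : ∀ t ∈ Set.Ioo (0:ℝ) T, ∀ ξ : Fin d → ℝ,
      0 ≤ ∑ i, ∑ j, a i j t * ξ i * ξ j)
    (ha_int : (∫⁻ t in Set.Ioo (0:ℝ) T,
      ENNReal.ofReal (∑ i, ∑ j, |a i j t|)) < ⊤)
    (ε : ℝ) (hε : 0 < ε)
    (hunif : ∀ r ∈ Set.Ioo (0:ℝ) T, ∀ ξ : Fin d → ℝ,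
      ε * ∑ i, ξ i ^ 2 ≤ ∑ i, ∑ j, a i j r * ξ i * ξ j)
    (g : Rd d → ℝ) (hg : ContDiff ℝ 2 g)
    (hgbd : ∃ C : ℝ, ∀ x : Rd d, |g x| ≤ C ∧ (∀ i, |pdrv d i g x| ≤ C) ∧
      (∀ i j, |pdrv d i (pdrv d j g) x| ≤ C)) :
    ∀ x : Rd d, ∀ s t : ℝ, 0 < s → s < t → t ≤ T →
      (∫ y, g (x + y) * gaussKernel d (covMat d a s t) y) =
        g x + ∫ ρ in Set.Ioo s t, ∑ i, ∑ j, a i j ρ *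
          ∫ y, pdrv d i (pdrv d j g) (x + y) * gaussKernel d (covMat d a s ρ) y := by
  obtain ⟨C, hCall⟩ := hgbd
  have hC : ∀ x, |g x| ≤ C := fun x => (hCall x).1
  have hC2 : ∀ x i j, |pdrv d i (pdrv d j g) x| ≤ C := fun x => (hCall x).2.2
  have hai := integrableOn_of_lintegral_sum_lt_top ha_meas ha_int
  have hpsd : ∀ p q : ℝ, 0 ≤ p → p ≤ q → q ≤ T → (covMat d a p q).PosSemidef :=
    fun p q => posSemidef_covMat hai ha_symm hε hunif
  intro x s t hs hst ht
  set u : ℝ → ℝ := fun ρ => ∫ y, g (x + y) ∂gaussMeas d (covMat d a s ρ) with hu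
  have hac : AbsolutelyContinuousOnInterval u s t :=
    absolutelyContinuousOnInterval_integral_gaussMeas hai hpsd hg hC hC2 x hs.le hst.le ht
  have hus : u s = g x := by simp [hu, covMat_self, gaussMeas_zero]
  have hgm : Measurable fun y => g (x + y) := by
    have := hg.continuous
    fun_prop
  have hDm : ∀ i j, Measurable fun y => pdrv d i (pdrv d j g) (x + y) := fun i j => by
    have := continuous_pdrv_pdrv hg i j
    fun_prop
  have hderiv : ∀ᵐ ρ : ℝ, ρ ∈ Set.Ioo s t → deriv u ρ = ∑ i, ∑ j, a i j ρ *
      ∫ y, pdrv d i (pdrv d j g) (x + y) * gaussKernel d (covMat d a s ρ) y := by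
    have hLeb : ∀ᵐ ρ : ℝ, ∀ i j, ρ ∈ Set.uIcc s t → ∀ c ∈ Set.uIcc s t,
        HasDerivAt (fun q => ∫ r in c..q, a i j r) (a i j ρ) ρ := by
      simp_rw [ae_all_iff]
      exact fun i j => (intervalIntegrable_coeff (hai i j) hs.le hst.le ht).ae_hasDerivAt_integral
    filter_upwards [hac.ae_differentiableAt, hLeb] with ρ hdiff hL hρ
    have hρ' : ρ ∈ Set.uIcc s t := by
      rw [Set.uIcc_of_le hst.le]
      exact Set.Ioo_subset_Icc_self hρ
    have h1 := (hdiff hρ').hasDerivAt.tendsto_slope_zero_right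
    have h2 := tendsto_slope_integral_gaussMeas hai hpsd hg hC hC2 x hs.le hρ.1.le
      (hρ.2.trans_le ht) fun i j => hL i j hρ' s Set.left_mem_uIcc
    have hpd := posDef_covMat hai ha_symm hε hunif hs.le hρ.1 (hρ.2.le.trans ht)
    simp_rw [integral_mul_gaussKernel hpd (hDm _ _)]
    exact tendsto_nhds_unique h1 h2
  rw [integral_mul_gaussKernel (posDef_covMat hai ha_symm hε hunif hs.le hst ht) hgm,
    ← setIntegral_congr_ae measurableSet_Ioo hderiv, ← integral_Ioc_eq_integral_Ioo,
    ← intervalIntegral.integral_of_le hst.le, hac.integral_deriv_eq_sub, hus]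
  ring
end
end

section
/- Let q ∈ (1,∞), T ∈ (0,∞), let δ : (0,T) → (0,∞) be measurable with ∫_0^T δ(t) dt < ∞, set α(t) = ∫_0^t δ(s) ds, and let w be a nonnegative locally integrable function on ℝ satisfying the A_q condition with constant K. Then ∫_0^T w(α(t)) δ(t) (∫_0^t w(α(s))^{-1/(q-1)} δ(s) ds)^{q-1} dt ≤ K · α(T)^q (an inequality in [0,∞]). -/
open MeasureTheory Real Set
open scoped ENNReal NNReal

noncomputable section

/-- `w` is a nonnegative locally integrable function on `ℝ` satisfying the
Muckenhoupt `A_q` condition with constant `K`. -/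
def MuckAq (q : ℝ) (K : ℝ≥0∞) (w : ℝ → ℝ) : Prop :=
  Measurable w ∧ (∀ x, 0 ≤ w x) ∧
  (∀ A B : ℝ, A < B → (∫⁻ t in Set.Ioo A B, ENNReal.ofReal (w t)) < ⊤) ∧
  ∀ A B : ℝ, A < B →
    ((ENNReal.ofReal (B - A))⁻¹ * ∫⁻ t in Set.Ioo A B, ENNReal.ofReal (w t)) *
      ((ENNReal.ofReal (B - A))⁻¹ * ∫⁻ t in Set.Ioo A B,
        (ENNReal.ofReal (w t)) ^ (-(1 / (q - 1)))) ^ (q - 1) ≤ K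

theorem setIntegral_Ioo_pos {a b : ℝ} (hab : a < b) {f : ℝ → ℝ}
    (hf_pos : ∀ t ∈ Ioo a b, 0 < f t) (hf : IntegrableOn f (Ioo a b)) :
    0 < ∫ t in Ioo a b, f t := by
  have hsub : Ioo a b ⊆ Function.support f := fun x hx => (hf_pos x hx).ne'
  rw [setIntegral_pos_iff_support_of_nonneg_ae _ hf, inter_eq_self_of_subset_right hsub]
  · simpa using hab
  · exact (ae_restrict_iff' measurableSet_Ioo).2 (.of_forall fun x hx => (hf_pos x hx).le)

/-- Change of variables along the primitive of a positive integrable density: the primitive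
pushes the density forward to Lebesgue measure. -/
theorem map_primitive_withDensity {T : ℝ} (hT : 0 < T) {δ : ℝ → ℝ}
    (hδ_pos : ∀ t ∈ Ioo (0 : ℝ) T, 0 < δ t) (hδ_int : IntegrableOn δ (Ioo 0 T)) {F : ℝ → ℝ}
    (hF_cont : Continuous F) (hF : ∀ t ∈ Icc (0 : ℝ) T, F t = ∫ s in Ioo (0 : ℝ) t, δ s) :
    ((volume.restrict (Ioo (0 : ℝ) T)).withDensity fun t => ENNReal.ofReal (δ t)).map F =
      volume.restrict (Ioo 0 (F T)) := by
  have hδ_on : ∀ t ∈ Icc (0 : ℝ) T, IntegrableOn δ (Ioo 0 t) := fun t ht =>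
    hδ_int.mono_set (Ioo_subset_Ioo_right ht.2)
  have hmass : ∀ t ∈ Icc (0 : ℝ) T,
      ∫⁻ s in Ioo (0 : ℝ) t, ENNReal.ofReal (δ s) = ENNReal.ofReal (F t) := by
    intro t ht
    rw [hF t ht, ofReal_integral_eq_lintegral_ofReal (hδ_on t ht)]
    exact (ae_restrict_iff' measurableSet_Ioo).2 (.of_forall fun s hs =>
      (hδ_pos s ⟨hs.1, hs.2.trans_le ht.2⟩).le)
  have hF0 : F 0 = 0 := by rw [hF 0 ⟨le_rfl, hT.le⟩]; simp
  have hstrict : StrictMonoOn F (Icc 0 T) := by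
    intro s hs t ht hst
    have hsub : Ioo s t ⊆ Ioo 0 T := Ioo_subset_Ioo hs.1 ht.2
    have hsplit : F t = F s + ∫ x in Ioo s t, δ x := by
      rw [hF t ht, hF s hs, ← integral_Ioc_eq_integral_Ioo, ← integral_Ioc_eq_integral_Ioo,
        ← integral_Ioc_eq_integral_Ioo, ← Ioc_union_Ioc_eq_Ioc hs.1 hst.le,
        setIntegral_union (Ioc_disjoint_Ioc_of_le le_rfl) measurableSet_Ioc]
      · exact (integrableOn_Ioc_iff_integrableOn_Ioo).2 (hδ_on s hs)
      · exact (integrableOn_Ioc_iff_integrableOn_Ioo).2 (hδ_int.mono_set hsub)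
    have hpos : 0 < ∫ x in Ioo s t, δ x :=
      setIntegral_Ioo_pos hst (fun x hx => hδ_pos x (hsub hx)) (hδ_int.mono_set hsub)
    linarith
  have hT' : T ∈ Icc (0 : ℝ) T := ⟨hT.le, le_rfl⟩
  have h0' : (0 : ℝ) ∈ Icc (0 : ℝ) T := ⟨le_rfl, hT.le⟩
  have hfin : IsFiniteMeasure
      ((volume.restrict (Ioo (0 : ℝ) T)).withDensity fun t => ENNReal.ofReal (δ t)) :=
    isFiniteMeasure_withDensity (by rw [hmass T hT']; exact ENNReal.ofReal_ne_top)
  refine Measure.ext_of_Iic _ _ fun x => ?_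
  rw [Measure.map_apply hF_cont.measurable measurableSet_Iic,
    withDensity_apply _ (hF_cont.measurable measurableSet_Iic),
    Measure.restrict_restrict (hF_cont.measurable measurableSet_Iic),
    Measure.restrict_apply measurableSet_Iic]
  rcases le_or_gt x 0 with hx | hx
  · have h1 : F ⁻¹' Iic x ∩ Ioo 0 T = ∅ := by
      refine eq_empty_of_forall_notMem fun t ht => ?_
      have := hstrict h0' (Ioo_subset_Icc_self ht.2) ht.2.1
      have h2 : F t ≤ x := ht.1
      linarith
    have h2 : Iic x ∩ Ioo 0 (F T) = ∅ :=
      eq_empty_of_forall_notMem fun t ht => (ht.2.1.trans_le (le_trans ht.1 hx)).false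
    rw [h1, h2]; simp
  rcases le_or_gt (F T) x with hx' | hx'
  · have h1 : F ⁻¹' Iic x ∩ Ioo 0 T = Ioo 0 T := inter_eq_self_of_subset_right fun t ht =>
      (hstrict (Ioo_subset_Icc_self ht) hT' ht.2).le.trans hx'
    have h2 : Iic x ∩ Ioo 0 (F T) = Ioo 0 (F T) :=
      inter_eq_self_of_subset_right fun t ht => ht.2.le.trans hx'
    rw [h1, h2, hmass T hT', Real.volume_Ioo, sub_zero]
  · obtain ⟨c, hc, rfl⟩ : x ∈ F '' Icc 0 T :=
      intermediate_value_Icc hT.le hF_cont.continuousOn ⟨hF0.le.trans hx.le, hx'.le⟩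
    have hcT : c < T := (hstrict.lt_iff_lt hc hT').1 hx'
    have h1 : F ⁻¹' Iic (F c) ∩ Ioo 0 T = Ioc 0 c := by
      ext t
      constructor
      · rintro ⟨h, ht⟩
        exact ⟨ht.1, (hstrict.le_iff_le (Ioo_subset_Icc_self ht) hc).1 h⟩
      · intro ht
        have ht' : t ∈ Ioo 0 T := ⟨ht.1, ht.2.trans_lt hcT⟩
        exact ⟨(hstrict.le_iff_le (Ioo_subset_Icc_self ht') hc).2 ht.2, ht'⟩
    have h2 : Iic (F c) ∩ Ioo 0 (F T) = Ioc 0 (F c) := by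
      ext y
      exact ⟨fun h => ⟨h.2.1, h.1⟩, fun h => ⟨h.2, h.1, h.2.trans_lt hx'⟩⟩
    rw [h1, h2, Real.volume_Ioc, sub_zero, restrict_Ioo_eq_restrict_Ioc.symm, hmass c hc]

theorem exists_continuous_eq_primitive {T : ℝ} {δ : ℝ → ℝ} (hδ_int : IntegrableOn δ (Ioo 0 T)) :
    ∃ F : ℝ → ℝ, Continuous F ∧ ∀ t ∈ Icc (0 : ℝ) T, F t = ∫ s in Ioo (0 : ℝ) t, δ s := by
  refine ⟨fun t => ∫ s in (0 : ℝ)..t, (Ioo 0 T).indicator δ s,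
    intervalIntegral.continuous_primitive (fun a b =>
      (hδ_int.integrable_indicator measurableSet_Ioo).intervalIntegrable) 0, fun t ht => ?_⟩
  simp only
  rw [intervalIntegral.integral_of_le ht.1, integral_Ioc_eq_integral_Ioo]
  exact setIntegral_congr_fun measurableSet_Ioo fun s hs =>
    indicator_of_mem (show s ∈ Ioo 0 T from ⟨hs.1, hs.2.trans_le ht.2⟩) δ

theorem lintegral_comp_primitive_mul {T : ℝ} (hT : 0 < T) {δ : ℝ → ℝ} (hδ_meas : Measurable δ)
    (hδ_pos : ∀ t ∈ Ioo (0 : ℝ) T, 0 < δ t) (hδ_int : IntegrableOn δ (Ioo 0 T))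
    {f : ℝ → ℝ≥0∞} (hf : Measurable f) :
    ∫⁻ t in Ioo (0 : ℝ) T, f (∫ s in Ioo (0 : ℝ) t, δ s) * ENNReal.ofReal (δ t) =
      ∫⁻ y in Ioo (0 : ℝ) (∫ s in Ioo (0 : ℝ) T, δ s), f y := by
  obtain ⟨F, hF_cont, hF⟩ := exists_continuous_eq_primitive hδ_int
  rw [← hF T ⟨hT.le, le_rfl⟩, ← map_primitive_withDensity hT hδ_pos hδ_int hF_cont hF,
    lintegral_map hf hF_cont.measurable,
    lintegral_withDensity_eq_lintegral_mul _ hδ_meas.ennreal_ofReal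
      (show Measurable fun t => f (F t) from hf.comp hF_cont.measurable)]
  refine setLIntegral_congr_fun measurableSet_Ioo fun t ht => ?_
  simp only [Pi.mul_apply]
  rw [hF t (Ioo_subset_Icc_self ht), mul_comm]

/-- for a Muckenhoupt `A_q` weight `w` with constant `K` and a
positive integrable `δ` on `(0,T)` with `α(t) = ∫_0^t δ`:
`∫_0^T w(α(t)) δ(t) (∫_0^t w(α(s))^{-1/(q-1)} δ(s) ds)^{q-1} dt ≤ K α(T)^q`. -/
theorem stmt14 (q : ℝ) (hq : 1 < q) (T : ℝ) (hT : 0 < T)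
    (δ : ℝ → ℝ) (hδ_meas : Measurable δ) (hδ_pos : ∀ t ∈ Set.Ioo (0:ℝ) T, 0 < δ t)
    (hδ_int : (∫⁻ t in Set.Ioo (0:ℝ) T, ENNReal.ofReal (δ t)) < ⊤)
    (w : ℝ → ℝ) (K : ℝ≥0∞) (hw : MuckAq q K w) :
    (∫⁻ t in Set.Ioo (0:ℝ) T,
        ENNReal.ofReal (w (∫ s in Set.Ioo (0:ℝ) t, δ s)) * ENNReal.ofReal (δ t) *
        (∫⁻ s in Set.Ioo (0:ℝ) t,
            (ENNReal.ofReal (w (∫ r in Set.Ioo (0:ℝ) s, δ r))) ^ (-(1 / (q - 1))) *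
              ENNReal.ofReal (δ s)) ^ (q - 1)) ≤
      K * (ENNReal.ofReal (∫ s in Set.Ioo (0:ℝ) T, δ s)) ^ q := by
  obtain ⟨hw_meas, -, -, hAq⟩ := hw
  have hδ_on : IntegrableOn δ (Ioo 0 T) := by
    refine ⟨hδ_meas.aestronglyMeasurable, ?_⟩
    rw [hasFiniteIntegral_iff_ofReal]
    · exact hδ_int
    · exact (ae_restrict_iff' measurableSet_Ioo).2 (.of_forall fun t ht => (hδ_pos t ht).le)
  have ha : 0 < ∫ s in Ioo (0 : ℝ) T, δ s := setIntegral_Ioo_pos hT hδ_pos hδ_on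
  have hq' : 0 ≤ q - 1 := by linarith
  have hW := lintegral_comp_primitive_mul hT hδ_meas hδ_pos hδ_on hw_meas.ennreal_ofReal
  have hJ := lintegral_comp_primitive_mul hT hδ_meas hδ_pos hδ_on
    (hw_meas.ennreal_ofReal.pow_const (-(1 / (q - 1))))
  have hK := hAq 0 _ ha
  rw [sub_zero] at hK
  set a := ∫ s in Ioo (0 : ℝ) T, δ s
  set W := ∫⁻ y in Ioo 0 a, ENNReal.ofReal (w y)
  set J := ∫⁻ y in Ioo 0 a, ENNReal.ofReal (w y) ^ (-(1 / (q - 1)))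
  have hb0 : ENNReal.ofReal a ≠ 0 := (ENNReal.ofReal_pos.2 ha).ne'
  have hbt : ENNReal.ofReal a ≠ ⊤ := ENNReal.ofReal_ne_top
  set b := ENNReal.ofReal a
  have hcancel : ∀ x : ℝ≥0∞, b * (b⁻¹ * x) = x := fun x => by
    rw [← mul_assoc, ENNReal.mul_inv_cancel hb0 hbt, one_mul]
  calc _ ≤ ∫⁻ t in Ioo (0 : ℝ) T, ENNReal.ofReal (w (∫ s in Ioo (0 : ℝ) t, δ s)) *
          ENNReal.ofReal (δ t) * J ^ (q - 1) := by
        refine setLIntegral_mono' measurableSet_Ioo fun t ht => ?_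
        rw [← hJ]
        gcongr
        exact ht.2.le
    _ ≤ W * J ^ (q - 1) := by
        rw [← hW]
        refine (lintegral_mul_const'' _ (AEMeasurable.mul ?_
          hδ_meas.ennreal_ofReal.aemeasurable)).le
        obtain ⟨F, hF_cont, hF⟩ := exists_continuous_eq_primitive hδ_on
        refine ⟨fun t => ENNReal.ofReal (w (F t)),
          (hw_meas.comp hF_cont.measurable).ennreal_ofReal,
          (ae_restrict_iff' measurableSet_Ioo).2 (.of_forall fun t ht => ?_)⟩
        simp only
        rw [hF t (Ioo_subset_Icc_self ht)]
    _ = (b⁻¹ * W) * (b⁻¹ * J) ^ (q - 1) * (b * b ^ (q - 1)) := by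
        conv_lhs => rw [← hcancel W, ← hcancel J, ENNReal.mul_rpow_of_nonneg _ _ hq']
        ring
    _ ≤ K * b ^ q := by
        have hbq : b * b ^ (q - 1) = b ^ q := by
          conv_lhs => rw [← ENNReal.rpow_one b, ← ENNReal.rpow_mul, one_mul,
            ← ENNReal.rpow_add _ _ hb0 hbt]
          congr 1
          ring
        rw [hbq]
        gcongr
end
end

section
/- Let p ∈ (1,∞), q ∈ (1,∞), let c : (0,T) → ℝ be locally integrable, let δ : (0,T) → [0,∞) be measurable with ∫_0^T δ(t) dt < ∞, set α(t) = ∫_0^t δ(s) ds, let w be a nonnegative locally integrable function on ℝ with w^{-1/(q-1)} locally integrable, and fix ε ∈ (0,1), with α_ε(t) = ∫_0^t (δ(s)+ε) ds. Then for every measurable f : (0,T)×ℝ^d → ℝ, every t ∈ (0,T) and every R > 0 there is a constant N = N(d,p,R) > 0 such that ∫_0^t ∫_{|x|<R} |f(s,x)| dx ds ≤ N · exp((q/(q−1))∫_0^t |c(s)| ds) · (∫_0^t ‖f(s,·)‖_{L_p}^q exp(−q∫_0^s c(ρ) dρ) w(α_ε(s)) (δ(s)+ε)^{1-q} ds)^{1/q}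 · (∫_0^{α(t)+t} w(s)^{-1/(q-1)} ds)^{(q-1)/q} (an inequality in [0,∞]). -/
open MeasureTheory Real Set
open scoped ENNReal NNReal

noncomputable section

/-- The primitive of an integrable function is measurable up to null sets. -/
theorem aemeasurable_setIntegral_Ioo {φ : ℝ → ℝ} {t : ℝ} (hφ : IntegrableOn φ (Ioo 0 t)) :
    AEMeasurable (fun s => ∫ r in Ioo 0 s, φ r) (volume.restrict (Ioo 0 t)) := by
  have hint : Integrable ((Ioo 0 t).indicator φ) :=
    (integrable_indicator_iff measurableSet_Ioo).2 hφ
  have hcont := intervalIntegral.continuous_primitive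
    (fun a b => hint.intervalIntegrable (a := a) (b := b)) 0
  refine hcont.measurable.aemeasurable.congr ?_
  filter_upwards [ae_restrict_mem measurableSet_Ioo] with s hs
  rw [intervalIntegral.integral_of_le hs.1.le, integral_Ioc_eq_integral_Ioo]
  refine setIntegral_congr_fun measurableSet_Ioo fun r hr => ?_
  have hrt : r ∈ Ioo 0 t := ⟨hr.1, hr.2.trans hs.2⟩
  exact indicator_of_mem hrt _

/-- Substitution along the primitive of a positive integrable function. -/
theorem lintegral_comp_primitive_mul_le {φ : ℝ → ℝ} {t : ℝ} (hφ : IntegrableOn φ (Ioo 0 t))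
    (hpos : ∀ s, 0 < φ s) (g : ℝ → ℝ≥0∞) :
    (∫⁻ s in Ioo 0 t, ENNReal.ofReal (φ s) * g (∫ r in Ioo 0 s, φ r)) ≤
      ∫⁻ u in Ioo 0 (∫ r in Ioo 0 t, φ r), g u := by
  rcases le_or_gt t 0 with ht | ht
  · simp [Ioo_eq_empty_of_le ht]
  set A : ℝ → ℝ := fun s => ∫ r in (0 : ℝ)..s, φ r with hA
  have hAIoo : ∀ s, 0 ≤ s → ∫ r in Ioo 0 s, φ r = A s := fun s hs => by
    simp only [hA]
    rw [intervalIntegral.integral_of_le hs, integral_Ioc_eq_integral_Ioo]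
  have hφt : IntervalIntegrable φ volume 0 t :=
    (intervalIntegrable_iff_integrableOn_Ioo_of_le ht.le).2 hφ
  have hmono : ∀ a b, 0 ≤ a → a < b → b ≤ t → A a < A b := fun a b ha hab hb => by
    have ha' : IntervalIntegrable φ volume 0 a := hφt.mono_set <| by
      rw [uIcc_of_le ha, uIcc_of_le ht.le]; exact Icc_subset_Icc_right (hab.le.trans hb)
    have hab' : IntervalIntegrable φ volume a b := hφt.mono_set <| by
      rw [uIcc_of_le hab.le, uIcc_of_le ht.le]; exact Icc_subset_Icc ha hb
    have h := intervalIntegral.intervalIntegral_pos_of_pos hab' hpos hab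
    rw [hA]
    beta_reduce
    rw [← intervalIntegral.integral_add_adjacent_intervals ha' hab']
    linarith
  obtain ⟨M, hNM, hM, hM0⟩ := exists_measurable_superset_of_null
    (ae_iff.1 hφt.ae_hasDerivAt_integral)
  have hderiv : ∀ x ∈ Ioo 0 t \ M, HasDerivWithinAt A (φ x) (Ioo 0 t \ M) x := fun x hx => by
    have hx' := not_not.1 fun h => hx.2 (hNM h)
    refine (hx' ?_ 0 left_mem_uIcc).hasDerivWithinAt
    rw [uIcc_of_le ht.le]
    exact Ioo_subset_Icc_self hx.1
  have hinj : InjOn A (Ioo 0 t \ M) := StrictMonoOn.injOn fun a ha b hb hab =>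
    hmono a b ha.1.1.le hab hb.1.2.le
  have hA0 : A 0 = 0 := by simp [hA]
  calc (∫⁻ s in Ioo 0 t, ENNReal.ofReal (φ s) * g (∫ r in Ioo 0 s, φ r))
      = ∫⁻ s in Ioo 0 t \ M, ENNReal.ofReal (φ s) * g (∫ r in Ioo 0 s, φ r) :=
        setLIntegral_congr (sdiff_null_ae_eq_self hM0).symm
    _ = ∫⁻ s in Ioo 0 t \ M, ENNReal.ofReal |φ s| * g (A s) :=
        setLIntegral_congr_fun (measurableSet_Ioo.diff hM) fun s hs => by
          rw [hAIoo s hs.1.1.le, abs_of_pos (hpos s)]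
    _ = ∫⁻ u in A '' (Ioo 0 t \ M), g u :=
        (lintegral_image_eq_lintegral_abs_deriv_mul (measurableSet_Ioo.diff hM) hderiv hinj g).symm
    _ ≤ ∫⁻ u in Ioo 0 (∫ r in Ioo 0 t, φ r), g u := by
        refine lintegral_mono_set ?_
        rintro _ ⟨s, hs, rfl⟩
        rw [hAIoo t ht.le]
        exact ⟨hA0 ▸ hmono 0 s le_rfl hs.1.1 hs.1.2.le, hmono s t hs.1.1.le hs.1.2 le_rfl⟩

/-- Slicewise `L^p` seminorms of a jointly measurable function depend measurably on the slice. -/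
theorem measurable_eLpNorm_slice {d : ℕ} {f : ℝ → Rd d → ℝ}
    (hf : Measurable (Function.uncurry f)) {p : ℝ≥0∞} (hp0 : p ≠ 0) (hp : p ≠ ⊤) :
    Measurable fun s => eLpNorm (f s) p volume := by
  simp_rw [eLpNorm_eq_lintegral_rpow_enorm_toReal hp0 hp]
  have h : Measurable fun z : ℝ × Rd d => ‖f z.1 z.2‖ₑ ^ p.toReal := hf.enorm.pow_const _
  exact h.lintegral_prod_right'.pow_const _

theorem volume_euclidean_ball_ne_top (d : ℕ) (R : ℝ) :
    volume {x : Rd d | ∑ i, x i ^ 2 < R ^ 2} ≠ ⊤ := by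
  refine ne_top_of_le_ne_top (isCompact_Icc (a := fun _ : Fin d => -|R|)
    (b := fun _ => |R|)).measure_lt_top.ne (measure_mono fun x hx => ?_)
  have h : ∀ i, |x i| ≤ |R| := fun i => sq_le_sq.1 <|
    (Finset.single_le_sum (fun j _ => sq_nonneg (x j)) (Finset.mem_univ i)).trans hx.le
  exact ⟨fun i => (abs_le.1 (h i)).1, fun i => (abs_le.1 (h i)).2⟩

/-- Hölder's inequality against the indicator of a set. -/
theorem setLIntegral_abs_le_rpow_mul_eLpNorm {d : ℕ} {g : Rd d → ℝ} (hg : Measurable g)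
    {p : ℝ≥0∞} (hp : 1 ≤ p) (B : Set (Rd d)) :
    (∫⁻ x in B, ENNReal.ofReal |g x|) ≤
      volume B ^ (1 - 1 / p.toReal) * eLpNorm g p volume := by
  have h := eLpNorm_le_eLpNorm_mul_rpow_measure_univ (μ := volume.restrict B) hp
    hg.aestronglyMeasurable
  rw [eLpNorm_one_eq_lintegral_enorm, Measure.restrict_apply_univ] at h
  simp_rw [Real.enorm_eq_ofReal_abs] at h
  refine h.trans ?_
  rw [mul_comm, ENNReal.toReal_one, div_one]
  gcongr
  exact Measure.restrict_le_self

/-- Pointwise splitting behind the weighted Hölder inequality. -/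
theorem le_exp_mul_rpow_mul_rpow {q : ℝ} (hq : 1 < q) {a b W D : ℝ} (hab : a ≤ b)
    (hW : 0 < W) (hD : 0 < D) (F : ℝ≥0∞) :
    F ≤ ENNReal.ofReal (Real.exp b) *
      ((F ^ q * ENNReal.ofReal (Real.exp (-q * a)) * ENNReal.ofReal W *
          ENNReal.ofReal D ^ (1 - q)) ^ (1 / q) *
        (ENNReal.ofReal D * ENNReal.ofReal W ^ (-(1 / (q - 1)))) ^ ((q - 1) / q)) := by
  have hq0 : 0 < q := by linarith
  have hq1 : 0 < q - 1 := by linarith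
  rw [ENNReal.ofReal_rpow_of_pos hD, ENNReal.ofReal_rpow_of_pos hW,
    ENNReal.mul_rpow_of_nonneg _ _ (by positivity : 0 ≤ 1 / q),
    ENNReal.mul_rpow_of_nonneg _ _ (by positivity : 0 ≤ 1 / q),
    ENNReal.mul_rpow_of_nonneg _ _ (by positivity : 0 ≤ 1 / q),
    ENNReal.mul_rpow_of_nonneg _ _ (by positivity : 0 ≤ (q - 1) / q),
    ← ENNReal.rpow_mul, mul_one_div_cancel hq0.ne', ENNReal.rpow_one,
    ENNReal.ofReal_rpow_of_pos (Real.exp_pos _), ENNReal.ofReal_rpow_of_pos hW,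
    ENNReal.ofReal_rpow_of_pos (by positivity), ENNReal.ofReal_rpow_of_pos hD,
    ENNReal.ofReal_rpow_of_pos (by positivity), ← Real.exp_mul, ← Real.rpow_mul hD.le,
    ← Real.rpow_mul hW.le]
  have e1 : -q * a * (1 / q) = -a := by field_simp
  have e2 : (1 - q) * (1 / q) = -((q - 1) / q) := by ring
  have e3 : -(1 / (q - 1)) * ((q - 1) / q) = -(1 / q) := by field_simp
  rw [e1, e2, e3]
  have hreal : 1 ≤ Real.exp b * (Real.exp (-a) * W ^ (1 / q) * D ^ (-((q - 1) / q)) *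
      (D ^ ((q - 1) / q) * W ^ (-(1 / q)))) := by
    have hWc : W ^ (1 / q) * W ^ (-(1 / q)) = 1 := by
      rw [← Real.rpow_add hW, add_neg_cancel, Real.rpow_zero]
    have hDc : D ^ (-((q - 1) / q)) * D ^ ((q - 1) / q) = 1 := by
      rw [← Real.rpow_add hD, neg_add_cancel, Real.rpow_zero]
    calc (1 : ℝ) ≤ Real.exp (b - a) := Real.one_le_exp (by linarith)
      _ = Real.exp b * Real.exp (-a) := by rw [← Real.exp_add, sub_eq_add_neg]
      _ = Real.exp b * Real.exp (-a) * (W ^ (1 / q) * W ^ (-(1 / q))) *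
          (D ^ (-((q - 1) / q)) * D ^ ((q - 1) / q)) := by rw [hWc, hDc]; ring
      _ = _ := by ring
  calc F = F * ENNReal.ofReal 1 := by simp
    _ ≤ F * ENNReal.ofReal (Real.exp b * (Real.exp (-a) * W ^ (1 / q) * D ^ (-((q - 1) / q)) *
      (D ^ ((q - 1) / q) * W ^ (-(1 / q))))) := by gcongr
    _ = _ := by
      rw [ENNReal.ofReal_mul (by positivity), ENNReal.ofReal_mul (by positivity),
        ENNReal.ofReal_mul (by positivity), ENNReal.ofReal_mul (by positivity),
        ENNReal.ofReal_mul (by positivity)]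
      ring

/-- local integrability of `f` from finiteness of the weighted
norm: there is `N = N(d,p,R) > 0` such that
`∫_0^t ∫_{|x|<R} |f| ≤ N e^{(q/(q-1))∫_0^t|c|}
(∫_0^t ‖f(s)‖_{L_p}^q e^{-q∫_0^s c} w(α_ε(s)) (δ(s)+ε)^{1-q} ds)^{1/q}
(∫_0^{α(t)+t} w^{-1/(q-1)})^{(q-1)/q}` (in `[0,∞]`). -/
theorem stmt16 (d : ℕ) (hd : 0 < d) (p : ℝ≥0∞) (hp : 1 < p) (hp' : p ≠ ⊤)
    (R : ℝ) (hR : 0 < R) :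
    ∃ N : ℝ≥0∞, 0 < N ∧ N ≠ ⊤ ∧
      ∀ (T : ℝ), 0 < T → ∀ (q : ℝ), 1 < q →
      ∀ (c : ℝ → ℝ), Measurable c →
        (∀ t ∈ Set.Ioo (0:ℝ) T, IntegrableOn c (Set.Ioo 0 t)) →
      ∀ (δ : ℝ → ℝ), Measurable δ → (∀ t, 0 ≤ δ t) →
        (∫⁻ t in Set.Ioo (0:ℝ) T, ENNReal.ofReal (δ t)) < ⊤ →
      ∀ (w : ℝ → ℝ), Measurable w → (∀ x, 0 ≤ w x) →
        (∀ r : ℝ, 0 < r → (∫⁻ s in Set.Ioo (-r) r, ENNReal.ofReal (w s)) < ⊤) →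
        (∀ r : ℝ, 0 < r →
          (∫⁻ s in Set.Ioo (-r) r, (ENNReal.ofReal (w s)) ^ (-(1 / (q - 1)))) < ⊤) →
      ∀ ε ∈ Set.Ioo (0:ℝ) 1,
      ∀ f : ℝ → Rd d → ℝ, Measurable (Function.uncurry f) →
      ∀ t ∈ Set.Ioo (0:ℝ) T,
        (∫⁻ s in Set.Ioo (0:ℝ) t, ∫⁻ x in {x : Rd d | ∑ i, x i ^ 2 < R ^ 2},
            ENNReal.ofReal |f s x|) ≤
          N * ENNReal.ofReal (Real.exp ((q / (q - 1)) * ∫ s in Set.Ioo (0:ℝ) t, |c s|)) *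
            (∫⁻ s in Set.Ioo (0:ℝ) t,
                (eLpNorm (f s) p volume) ^ q *
                ENNReal.ofReal (Real.exp (-q * ∫ ρ in Set.Ioo (0:ℝ) s, c ρ)) *
                ENNReal.ofReal (w (∫ r in Set.Ioo (0:ℝ) s, (δ r + ε))) *
                (ENNReal.ofReal (δ s + ε)) ^ (1 - q)) ^ (1 / q) *
            (∫⁻ s in Set.Ioo (0:ℝ) ((∫ r in Set.Ioo (0:ℝ) t, δ r) + t),
                (ENNReal.ofReal (w s)) ^ (-(1 / (q - 1)))) ^ ((q - 1) / q) := by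
  set B : Set (Rd d) := {x | ∑ i, x i ^ 2 < R ^ 2}
  have hp1 : 0 ≤ 1 - 1 / p.toReal := by
    have : 1 ≤ p.toReal := by
      simpa using ENNReal.toReal_mono hp' hp.le
    have := div_le_one_of_le₀ this (by linarith)
    linarith
  refine ⟨volume B ^ (1 - 1 / p.toReal) + 1, by positivity,
    ENNReal.add_ne_top.2 ⟨ENNReal.rpow_ne_top_of_nonneg hp1 (volume_euclidean_ball_ne_top d R),
      ENNReal.one_ne_top⟩, ?_⟩
  intro T hT q hq c hc hcint δ hδ hδ0 hδint w hw hw0 _ hwint ε hε f hf t ht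
  have hq0 : 0 < q := by linarith
  have hq1 : 0 < q - 1 := by linarith
  have hct := hcint t ht
  have hδt : IntegrableOn δ (Ioo 0 t) := by
    refine ⟨hδ.aestronglyMeasurable, ?_⟩
    rw [hasFiniteIntegral_iff_ofReal (ae_of_all _ hδ0)]
    exact (lintegral_mono_set (Ioo_subset_Ioo_right ht.2.le)).trans_lt hδint
  have hεt : IntegrableOn (fun _ : ℝ => ε) (Ioo 0 t) := integrableOn_const (by simp)
  have hφ : IntegrableOn (fun r => δ r + ε) (Ioo 0 t) := hδt.add hεt
  have hφpos : ∀ s, 0 < δ s + ε := fun s => add_pos_of_nonneg_of_pos (hδ0 s) hε.1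
  set α : ℝ → ℝ := fun s => ∫ r in Ioo (0:ℝ) s, (δ r + ε) with hα
  have hαm : AEMeasurable α (volume.restrict (Ioo 0 t)) := aemeasurable_setIntegral_Ioo hφ
  have hαt : α t ≤ (∫ r in Ioo (0:ℝ) t, δ r) + t := by
    have : α t = (∫ r in Ioo (0:ℝ) t, δ r) + t * ε := by
      rw [hα]
      beta_reduce
      rw [integral_add hδt hεt]
      simp [ht.1.le]
    rw [this]
    nlinarith [hε.2, ht.1]
  set V : ℝ → ℝ≥0∞ := fun u => ENNReal.ofReal (w u) ^ (-(1 / (q - 1))) with hV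
  have hVm : Measurable V := hw.ennreal_ofReal.pow_const _
  set H : ℝ → ℝ≥0∞ := fun s => ENNReal.ofReal (δ s + ε) * V (α s) with hH
  set G : ℝ → ℝ≥0∞ := fun s => eLpNorm (f s) p volume ^ q *
    ENNReal.ofReal (Real.exp (-q * ∫ ρ in Ioo (0:ℝ) s, c ρ)) *
    ENNReal.ofReal (w (α s)) * ENNReal.ofReal (δ s + ε) ^ (1 - q)
  set J := ∫⁻ u in Ioo (0:ℝ) ((∫ r in Ioo (0:ℝ) t, δ r) + t), V u
  have hHle : (∫⁻ s in Ioo (0:ℝ) t, H s) ≤ J :=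
    (lintegral_comp_primitive_mul_le hφ hφpos V).trans
      (lintegral_mono_set (Ioo_subset_Ioo_right hαt))
  have hJtop : J < ⊤ := by
    have h0 : 0 < (∫ r in Ioo (0:ℝ) t, δ r) + t :=
      add_pos_of_nonneg_of_pos (integral_nonneg hδ0) ht.1
    exact (lintegral_mono_set (Ioo_subset_Ioo_left (by linarith))).trans_lt (hwint _ h0)
  have hHm : AEMeasurable H (volume.restrict (Ioo 0 t)) :=
    (hδ.add_const ε).ennreal_ofReal.aemeasurable.mul (hVm.comp_aemeasurable hαm)
  have hGm : AEMeasurable G (volume.restrict (Ioo 0 t)) := by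
    have hE := (measurable_eLpNorm_slice hf (zero_lt_one.trans hp).ne' hp').pow_const q
    have hC := (Real.measurable_exp.comp_aemeasurable
      ((aemeasurable_setIntegral_Ioo hct).const_mul (-q))).ennreal_ofReal
    have hW := (hw.comp_aemeasurable hαm).ennreal_ofReal
    exact ((hE.aemeasurable.mul hC).mul hW).mul
      ((hδ.add_const ε).ennreal_ofReal.pow_const _).aemeasurable
  set K := ENNReal.ofReal (Real.exp (∫ s in Ioo (0:ℝ) t, |c s|))
  have hpoint : ∀ᵐ s ∂volume.restrict (Ioo 0 t), eLpNorm (f s) p volume ≤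
      K * (G s ^ (1 / q) * H s ^ ((q - 1) / q)) := by
    filter_upwards [ae_restrict_mem measurableSet_Ioo,
      ae_lt_top' hHm (hHle.trans_lt hJtop).ne] with s hs hHs
    have hwpos : 0 < w (α s) := by
      refine lt_of_le_of_ne (hw0 _) fun h => hHs.ne ?_
      simp only [hH, hV, ← h, ENNReal.ofReal_zero]
      rw [ENNReal.zero_rpow_of_neg (by simpa using hq1), ENNReal.mul_top]
      simpa using hφpos s
    refine le_exp_mul_rpow_mul_rpow hq ?_ hwpos (hφpos s) _
    calc (∫ ρ in Ioo (0:ℝ) s, c ρ) ≤ ∫ ρ in Ioo (0:ℝ) s, |c ρ| :=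
          (le_abs_self _).trans (abs_integral_le_integral_abs)
      _ ≤ ∫ ρ in Ioo (0:ℝ) t, |c ρ| :=
          setIntegral_mono_set hct.abs (ae_of_all _ fun _ => abs_nonneg _)
            (Ioo_subset_Ioo_right hs.2.le).eventuallyLE
  have hHolder : (∫⁻ s in Ioo (0:ℝ) t, G s ^ (1 / q) * H s ^ ((q - 1) / q)) ≤
      (∫⁻ s in Ioo (0:ℝ) t, G s) ^ (1 / q) * (∫⁻ s in Ioo (0:ℝ) t, H s) ^ ((q - 1) / q) := by
    have hconj : q.HolderConjugate (q / (q - 1)) := Real.HolderConjugate.conjExponent hq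
    have h := ENNReal.lintegral_mul_le_Lp_mul_Lq (volume.restrict (Ioo 0 t)) hconj
      (hGm.pow_const (1 / q)) (hHm.pow_const ((q - 1) / q))
    simpa only [Pi.mul_apply, ← ENNReal.rpow_mul, one_div_mul_cancel hq0.ne',
      div_mul_div_cancel₀ hq0.ne', div_self hq1.ne', ENNReal.rpow_one, one_div_div] using h
  have hKle : K ≤ ENNReal.ofReal (Real.exp ((q / (q - 1)) * ∫ s in Ioo (0:ℝ) t, |c s|)) := by
    refine ENNReal.ofReal_le_ofReal (Real.exp_le_exp.2 ?_)
    refine le_mul_of_one_le_left (integral_nonneg fun _ => abs_nonneg _) ?_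
    rw [one_le_div hq1]
    linarith
  have hslice : ∀ s, Measurable (f s) := fun s => hf.comp measurable_prodMk_left
  calc (∫⁻ s in Ioo (0:ℝ) t, ∫⁻ x in B, ENNReal.ofReal |f s x|)
      ≤ ∫⁻ s in Ioo (0:ℝ) t, (volume B ^ (1 - 1 / p.toReal) + 1) *
          (K * (G s ^ (1 / q) * H s ^ ((q - 1) / q))) := by
        refine lintegral_mono_ae ?_
        filter_upwards [hpoint] with s hs
        exact (setLIntegral_abs_le_rpow_mul_eLpNorm (hslice s) hp.le B).trans
          (mul_le_mul' le_self_add hs)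
    _ = (volume B ^ (1 - 1 / p.toReal) + 1) *
          (K * ∫⁻ s in Ioo (0:ℝ) t, G s ^ (1 / q) * H s ^ ((q - 1) / q)) := by
        have hm : AEMeasurable (fun s => G s ^ (1 / q) * H s ^ ((q - 1) / q))
            (volume.restrict (Ioo 0 t)) :=
          (hGm.pow_const (1 / q)).mul (hHm.pow_const ((q - 1) / q))
        rw [lintegral_const_mul'' _ (hm.const_mul K), lintegral_const_mul'' _ hm]
    _ ≤ (volume B ^ (1 - 1 / p.toReal) + 1) *
          (ENNReal.ofReal (Real.exp ((q / (q - 1)) * ∫ s in Ioo (0:ℝ) t, |c s|)) *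
            ((∫⁻ s in Ioo (0:ℝ) t, G s) ^ (1 / q) * J ^ ((q - 1) / q))) := by
        have hJle := ENNReal.rpow_le_rpow hHle (div_nonneg hq1.le hq0.le)
        exact mul_le_mul' le_rfl (mul_le_mul' hKle (hHolder.trans (mul_le_mul' le_rfl hJle)))
    _ = _ := by simp only [mul_assoc]
end
end
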